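/- arXiv:cs/0204045 — 6 statements merged into one kernel-verified Lean document; each statement's English description precedes it below -/
import Mathlib

section
/- Let P(|f|,|x⃗|) and Q(|f|,|x⃗|) be second-order polynomials and let G(f,x⃗) and H(f,x⃗,z,y) be basic feasible functionals. Assume the functional F*(f,x⃗,y) satisfies: F*(f,x⃗,0) = G(f,x⃗); F*(f,x⃗,y+1) = H(f,x⃗,F*(f,x⃗,y),y); (∀y ≤ P(|f|,|x⃗|)) |F*(f,x⃗,y)| ≤ Q(|f|,|x⃗|); (∀y)(y ≥ P(|f|,|x⃗|) → F*(f,x⃗,y) = F*(f,x⃗,P(|f|,|x⃗|))); and the stability condition (∀f)(∀f*)(((∀y ≤ P(|f|,|x⃗|)) F*(f,x⃗,y) = F*(f*,x⃗,y)) → (∀y) F*(f,x⃗,y) = F*(f*,x⃗,y)). If the functional F is defined by F(f,x⃗) = F*(f,x⃗,P(|f|,|x⃗|)) (i.e., F is defined from G and H by polynomially bounded recursion of polynomial length with bounds (Q,P)), then F(f,x⃗) is a basic feasible functional. -/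
/-- The smash function: `x # y = 2^(|x|·|y|)`, where `|x| = Nat.size x` is the binary length. -/
def smash (x y : ℕ) : ℕ := 2 ^ (Nat.size x * Nat.size y)

/-- The class BFF of basic feasible functionals.  A type 2 functional of rank `(k,l)` is
represented as a map `(Fin k → ℕ → ℕ) → (Fin l → ℕ) → ℕ`. -/
inductive BFF : (k l : ℕ) → ((Fin k → ℕ → ℕ) → (Fin l → ℕ) → ℕ) → Prop
  | zero : BFF 0 1 (fun _ _ => 0)
  | s0 : BFF 0 1 (fun _ x => 2 * x 0)
  | s1 : BFF 0 1 (fun _ x => 2 * x 0 + 1)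
  | proj (n : ℕ) (i : Fin n) : BFF 0 n (fun _ x => x i)
  | smashF : BFF 0 2 (fun _ x => smash (x 0) (x 1))
  | ap : BFF 1 1 (fun f x => f 0 (x 0))
  | expansion {k l k' l' : ℕ} (ρ : Fin k → Fin k') (σ : Fin l → Fin l')
      (hρ : Function.Injective ρ) (hσ : Function.Injective σ)
      {G : (Fin k → ℕ → ℕ) → (Fin l → ℕ) → ℕ} (hG : BFF k l G) :
      BFF k' l' (fun f x => G (fun i => f (ρ i)) (fun j => x (σ j)))
  | comp {k l m : ℕ} {H : (Fin k → ℕ → ℕ) → (Fin (m + l) → ℕ) → ℕ}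
      {G : Fin m → (Fin k → ℕ → ℕ) → (Fin l → ℕ) → ℕ}
      (hH : BFF k (m + l) H) (hG : ∀ i, BFF k l (G i)) :
      BFF k l (fun f x => H f (Fin.append (fun i => G i f x) x))
  | lrn {k l : ℕ} (F : (Fin k → ℕ → ℕ) → (Fin (l + 1) → ℕ) → ℕ)
      {G : (Fin k → ℕ → ℕ) → (Fin l → ℕ) → ℕ}
      {H₁ H₂ : (Fin k → ℕ → ℕ) → (Fin (l + 2) → ℕ) → ℕ}
      {K : (Fin k → ℕ → ℕ) → (Fin (l + 1) → ℕ) → ℕ}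
      (hG : BFF k l G) (hH₁ : BFF k (l + 2) H₁) (hH₂ : BFF k (l + 2) H₂)
      (hK : BFF k (l + 1) K)
      (hbase : ∀ f x, F f (Fin.snoc x 0) = G f x)
      (heven : ∀ f x y, 0 < y →
        F f (Fin.snoc x (2 * y)) = H₁ f (Fin.snoc (Fin.snoc x y) (F f (Fin.snoc x y))))
      (hodd : ∀ f x y,
        F f (Fin.snoc x (2 * y + 1)) = H₂ f (Fin.snoc (Fin.snoc x y) (F f (Fin.snoc x y))))
      (hbound : ∀ f x, Nat.size (F f x) ≤ Nat.size (K f x)) :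
      BFF k (l + 1) F
/-- The norm `|f|` of `f : ℕ → ℕ`: `|f|(x) = max { |f(y)| : |y| ≤ x }`. -/
def fnorm (f : ℕ → ℕ) (x : ℕ) : ℕ :=
  (Finset.range (2 ^ x)).sup fun y => Nat.size (f y)

/-- Second-order polynomials in the norms `|f₁|, …, |f_k|` of `k` function variables and
the lengths `|x₁|, …, |x_l|` of `l` number variables. -/
inductive SOPoly (k l : ℕ) : Type
  | const : ℕ → SOPoly k l
  | len : Fin l → SOPoly k l
  | add : SOPoly k l → SOPoly k l → SOPoly k l
  | mul : SOPoly k l → SOPoly k l → SOPoly k l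
  | app : Fin k → SOPoly k l → SOPoly k l

/-- Evaluation of a second-order polynomial at concrete arguments: `|f_i|` is interpreted
as the norm of `f_i` and `|x_j|` as the binary length of `x_j`. -/
def SOPoly.eval {k l : ℕ} (f : Fin k → ℕ → ℕ) (x : Fin l → ℕ) : SOPoly k l → ℕ
  | const n => n
  | len j => Nat.size (x j)
  | add p q => p.eval f x + q.eval f x
  | mul p q => p.eval f x * q.eval f x
  | app i p => fnorm (f i) (p.eval f x)

/-- The depth of a second-order polynomial: the maximal nesting of the applications `|f_i|(·)`. -/
def SOPoly.depth {k l : ℕ} : SOPoly k l → ℕ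
  | const _ => 0
  | len _ => 0
  | add p q => max p.depth q.depth
  | mul p q => max p.depth q.depth
  | app _ p => p.depth + 1


namespace BFFProof

local notation "sn" => @Fin.snoc _ (fun _ => ℕ)

/-- Function arguments of rank `k`. -/
abbrev Fn (k : ℕ) := Fin k → ℕ → ℕ
/-- Number arguments of rank `l`. -/
abbrev Vc (l : ℕ) := Fin l → ℕ

/-- All components of an environment map are basic feasible. -/
def Sub (k m l : ℕ) (A : Fn k → Vc m → Vc l) : Prop := ∀ i, BFF k m (fun f x => A f x i)

/-- Predicates with a basic feasible characteristic function. -/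
def BP (k l : ℕ) (p : Fn k → Vc l → Prop) : Prop :=
  open Classical in BFF k l (fun f x => if p f x then 1 else 0)

theorem bff_pos {k l : ℕ} {F} (h : BFF k l F) : 0 < l := by
  induction h with
  | zero => omega
  | s0 => omega
  | s1 => omega
  | proj n i => exact i.pos
  | smashF => omega
  | ap => omega
  | expansion ρ σ hρ hσ hG ih => exact (σ ⟨0, ih⟩).pos
  | @comp k l m H G hH hG ih1 ih2 =>
    rcases Nat.eq_zero_or_pos l with h | h
    · subst h
      rcases Nat.eq_zero_or_pos m with h | h
      · subst h; simp at ih1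
      · exact ih2 ⟨0, h⟩
    · exact h
  | lrn => omega

theorem bff_congr {k l : ℕ} {p q : Fn k → Vc l → ℕ} (hp : BFF k l p)
    (h : ∀ f x, p f x = q f x) : BFF k l q := by
  have : p = q := by funext f x; exact h f x
  exact this ▸ hp

theorem bff_comp {k l m : ℕ} {H : Fn k → Vc l → ℕ} {A : Fn k → Vc m → Vc l}
    (hH : BFF k l H) (hA : Sub k m l A) : BFF k m (fun f x => H f (A f x)) := by
  have h1 := BFF.expansion (k' := k) (l' := l + m) id (Fin.castAdd m)
    Function.injective_id (Fin.castAdd_injective l m) hH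
  have h2 := BFF.comp (G := fun i f x => A f x i) h1 hA
  simpa using h2

theorem bff_lift {k l : ℕ} {H : Fn 0 → Vc l → ℕ} (hH : BFF 0 l H) :
    BFF k l (fun _ x => H (fun i => i.elim0) x) := by
  have h1 := BFF.expansion (k' := k) (l' := l) (fun i => i.elim0) id
    (fun i => i.elim0) Function.injective_id hH
  have e : ∀ f : Fn k, (fun i : Fin 0 => f (i.elim0)) = (fun i => i.elim0) :=
    fun f => Subsingleton.elim _ _
  exact bff_congr h1 (fun f x => by simp only [id]; rw [e])

theorem bff_var {k l : ℕ} (i : Fin l) : BFF k l (fun _ x => x i) := bff_lift (BFF.proj l i)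

theorem bff_last {k l : ℕ} : BFF k (l + 1) (fun _ x => x (Fin.last l)) := bff_var _

theorem sub_id {k l : ℕ} : Sub k l l (fun _ x => x) := fun i => bff_var i

theorem sub_init {k l m : ℕ} {A : Fn k → Vc m → Vc (l + 1)} (h : Sub k m (l + 1) A) :
    Sub k m l (fun f x => Fin.init (α := fun _ => ℕ) (A f x)) := fun i => h i.castSucc

theorem sub_init' {k l : ℕ} : Sub k (l + 1) l (fun _ x => Fin.init (α := fun _ => ℕ) x) :=
  sub_init sub_id

theorem sub_snoc {k l m : ℕ} {A : Fn k → Vc m → Vc l} {B : Fn k → Vc m → ℕ}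
    (h : Sub k m l A) (hB : BFF k m B) : Sub k m (l + 1) (fun f x => sn (A f x) (B f x)) := by
  intro i
  refine Fin.lastCases ?_ (fun i => ?_) i
  · simpa using hB
  · simpa using h i

theorem sub_comp {k l m n : ℕ} {A : Fn k → Vc m → Vc l} {B : Fn k → Vc n → Vc m}
    (h : Sub k m l A) (hB : Sub k n m B) : Sub k n l (fun f x => A f (B f x)) :=
  fun i => bff_comp (h i) hB

theorem bff_comp1 {k l : ℕ} {H : Fn k → Vc 1 → ℕ} {A : Fn k → Vc l → ℕ}
    (hH : BFF k 1 H) (hA : BFF k l A) : BFF k l (fun f x => H f ![A f x]) := by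
  refine bff_comp (A := fun f x => ![A f x]) hH (fun i => ?_)
  fin_cases i; exact hA

theorem bff_comp2 {k l : ℕ} {H : Fn k → Vc 2 → ℕ} {A B : Fn k → Vc l → ℕ}
    (hH : BFF k 2 H) (hA : BFF k l A) (hB : BFF k l B) :
    BFF k l (fun f x => H f ![A f x, B f x]) := by
  refine bff_comp (A := fun f x => ![A f x, B f x]) hH (fun i => ?_)
  fin_cases i
  · exact hA
  · exact hB

theorem bff_comp3 {k l : ℕ} {H : Fn k → Vc 3 → ℕ} {A B C : Fn k → Vc l → ℕ}
    (hH : BFF k 3 H) (hA : BFF k l A) (hB : BFF k l B) (hC : BFF k l C) :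
    BFF k l (fun f x => H f ![A f x, B f x, C f x]) := by
  refine bff_comp (A := fun f x => ![A f x, B f x, C f x]) hH (fun i => ?_)
  fin_cases i
  · exact hA
  · exact hB
  · exact hC

theorem bff_s0 {k l : ℕ} {A : Fn k → Vc l → ℕ} (hA : BFF k l A) :
    BFF k l (fun f x => 2 * A f x) := bff_comp1 (bff_lift BFF.s0) hA

theorem bff_s1 {k l : ℕ} {A : Fn k → Vc l → ℕ} (hA : BFF k l A) :
    BFF k l (fun f x => 2 * A f x + 1) := bff_comp1 (bff_lift BFF.s1) hA

theorem bff_smash {k l : ℕ} {A B : Fn k → Vc l → ℕ} (hA : BFF k l A) (hB : BFF k l B) :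
    BFF k l (fun f x => smash (A f x) (B f x)) := bff_comp2 (bff_lift BFF.smashF) hA hB

theorem bff_zero {k l : ℕ} (h : 0 < l) : BFF k l (fun _ _ => 0) :=
  bff_comp1 (bff_lift BFF.zero) (bff_var ⟨0, h⟩)

theorem bff_one {k l : ℕ} (h : 0 < l) : BFF k l (fun _ _ => 1) := by
  simpa using bff_s1 (bff_zero (k := k) h)

theorem bff_two {k l : ℕ} (h : 0 < l) : BFF k l (fun _ _ => 2) := by
  simpa using bff_s0 (bff_one (k := k) h)

theorem bff_ap {k l : ℕ} (i : Fin k) {A : Fn k → Vc l → ℕ} (hA : BFF k l A) :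
    BFF k l (fun f x => f i (A f x)) := by
  have h1 := BFF.expansion (k' := k) (l' := 1) (fun _ => i) id
    (fun a b _ => Subsingleton.elim a b) Function.injective_id BFF.ap
  exact bff_comp1 h1 hA

theorem size_smash (a b : ℕ) : Nat.size (smash a b) = Nat.size a * Nat.size b + 1 := by
  unfold smash; exact Nat.size_pow

theorem size_two_mul (a : ℕ) : Nat.size a ≤ Nat.size (2 * a) := Nat.size_le_size (by omega)

theorem size_s1 (a : ℕ) : Nat.size (2 * a + 1) = Nat.size a + 1 := by
  simpa [Nat.bit] using Nat.size_bit (b := true) (n := a) (by simp [Nat.bit])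

theorem size_s0 (a : ℕ) (h : 0 < a) : Nat.size (2 * a) = Nat.size a + 1 := by
  simpa [Nat.bit] using Nat.size_bit (b := false) (n := a) (by simp [Nat.bit]; omega)

/-- A convenient bound whose size dominates both sizes. -/
def big (a b : ℕ) : ℕ := smash (2 * a + 1) (2 * b + 1)

theorem size_big (a b : ℕ) : Nat.size a + Nat.size b ≤ Nat.size (big a b) := by
  unfold big; rw [size_smash, size_s1, size_s1]; nlinarith [Nat.zero_le (Nat.size a * Nat.size b)]

theorem bff_big {k l : ℕ} {A B : Fn k → Vc l → ℕ} (hA : BFF k l A) (hB : BFF k l B) :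
    BFF k l (fun f x => big (A f x) (B f x)) := bff_smash (bff_s1 hA) (bff_s1 hB)

/-- case distinction on a number being zero -/
theorem bff_cond0 {k l : ℕ} {A B C : Fn k → Vc l → ℕ} (hA : BFF k l A) (hB : BFF k l B)
    (hC : BFF k l C) : BFF k l (fun f x => if A f x = 0 then B f x else C f x) := by
  have h : BFF k 3 (fun _ x => if x 2 = 0 then x 0 else x 1) := by
    refine BFF.lrn (l := 2) (G := fun _ x => x 0) (H₁ := fun _ x => x 1) (H₂ := fun _ x => x 1)
      (K := fun _ x => big (x 0) (x 1)) _ (bff_var _) (bff_var _) (bff_var _)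
      (bff_big (bff_var _) (bff_var _)) ?_ ?_ ?_ ?_
    · intro f x; simp [Fin.snoc]
    · intro f x y hy; simp [Fin.snoc]; omega
    · intro f x y; simp [Fin.snoc]
    · intro f x
      have := size_big (x 0) (x 1)
      split_ifs <;> omega
  exact bff_comp3 h hB hC hA

theorem bff_ite {k l : ℕ} {p : Fn k → Vc l → Prop} {B C : Fn k → Vc l → ℕ}
    [∀ f x, Decidable (p f x)] (hp : BP k l p) (hB : BFF k l B)
    (hC : BFF k l C) : BFF k l (fun f x => if p f x then B f x else C f x) := by
  have h := bff_cond0 hp hC hB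
  convert h using 3 with f x
  by_cases h : p f x <;> simp [h]

theorem bp_not {k l : ℕ} {p : Fn k → Vc l → Prop} (hp : BP k l p) :
    BP k l (fun f x => ¬ p f x) := by
  classical
  have := bff_ite hp (bff_zero (bff_pos hp)) (bff_one (bff_pos hp))
  unfold BP
  convert this using 3 with f x
  by_cases h : p f x <;> simp [h]

theorem bp_and {k l : ℕ} {p q : Fn k → Vc l → Prop} (hp : BP k l p) (hq : BP k l q) :
    BP k l (fun f x => p f x ∧ q f x) := by
  classical
  have := bff_ite hp hq (bff_zero (bff_pos hp))
  unfold BP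
  convert this using 3 with f x
  by_cases h : p f x <;> simp [h]

theorem bp_or {k l : ℕ} {p q : Fn k → Vc l → Prop} (hp : BP k l p) (hq : BP k l q) :
    BP k l (fun f x => p f x ∨ q f x) := by
  classical
  have := bff_ite hp (bff_one (bff_pos hp)) hq
  unfold BP
  convert this using 3 with f x
  by_cases h : p f x <;> simp [h]

theorem bp_comp {k l m : ℕ} {p : Fn k → Vc l → Prop} {A : Fn k → Vc m → Vc l}
    (hp : BP k l p) (hA : Sub k m l A) : BP k m (fun f x => p f (A f x)) := bff_comp hp hA

theorem bp_congr {k l : ℕ} {p q : Fn k → Vc l → Prop} (hp : BP k l p)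
    (h : ∀ f x, p f x ↔ q f x) : BP k l q := by
  have : p = q := by funext f x; exact propext (h f x)
  exact this ▸ hp

theorem bp_zero {k l : ℕ} {A : Fn k → Vc l → ℕ} (hA : BFF k l A) :
    BP k l (fun f x => A f x = 0) := by
  classical
  exact bff_congr (bff_cond0 hA (bff_one (bff_pos hA)) (bff_zero (bff_pos hA)))
    (fun f x => by congr)

/-- Raw limited iteration. -/
theorem bff_iter0 {k l : ℕ} {G : Fn k → Vc l → ℕ} {S : Fn k → Vc (l + 2) → ℕ}
    {K : Fn k → Vc (l + 1) → ℕ} (hG : BFF k l G) (hS : BFF k (l + 2) S) (hK : BFF k (l + 1) K)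
    (R : Fn k → Vc l → ℕ → ℕ) (h0 : ∀ f x, R f x 0 = G f x)
    (h1 : ∀ f x y, R f x (Nat.size y + 1) = S f (sn (sn x y) (R f x (Nat.size y))))
    (hb : ∀ f x y, Nat.size (R f x (Nat.size y)) ≤ Nat.size (K f (sn x y))) :
    BFF k (l + 1) (fun f x => R f (Fin.init (α := fun _ => ℕ) x) (Nat.size (x (Fin.last l)))) := by
  refine BFF.lrn _ hG hS hS hK ?_ ?_ ?_ ?_
  · intro f x; simp [h0]
  · intro f x y hy; simp [size_s0 y hy, h1]
  · intro f x y; simp [size_s1, h1]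
  · intro f x
    have := hb f (Fin.init (α := fun _ => ℕ) x) (x (Fin.last l))
    simpa using this

theorem bff_half {k l : ℕ} {A : Fn k → Vc l → ℕ} (hA : BFF k l A) :
    BFF k l (fun f x => A f x / 2) := by
  have h : BFF k 2 (fun _ x => x 1 / 2) := by
    refine BFF.lrn (l := 1) (G := fun _ _ => 0) (H₁ := fun _ x => x 1) (H₂ := fun _ x => x 1)
      (K := fun _ x => x 1) _ (bff_zero one_pos) (bff_var _) (bff_var _)
      (bff_var _) ?_ ?_ ?_ ?_
    · intro f x; simp [Fin.snoc]
    · intro f x y hy; simp [Fin.snoc]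
    · intro f x y; simp [Fin.snoc]; omega
    · intro f x
      exact Nat.size_le_size (by omega)
  exact bff_comp2 h hA hA

theorem bff_parity {k l : ℕ} {A : Fn k → Vc l → ℕ} (hA : BFF k l A) :
    BFF k l (fun f x => A f x % 2) := by
  have h : BFF k 2 (fun _ x => x 1 % 2) := by
    refine BFF.lrn (l := 1) (G := fun _ _ => 0) (H₁ := fun _ x => 0) (H₂ := fun _ x => 1)
      (K := fun _ x => x 1) _ (bff_zero one_pos) (bff_zero (by omega)) (bff_one (by omega))
      (bff_var _) ?_ ?_ ?_ ?_
    · intro f x; simp [Fin.snoc]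
    · intro f x y hy; simp [Fin.snoc]
    · intro f x y; simp [Fin.snoc]
    · intro f x
      exact Nat.size_le_size (Nat.mod_le _ _)
  exact bff_comp2 h hA hA

theorem bff_succ {k l : ℕ} {A : Fn k → Vc l → ℕ} (hA : BFF k l A) :
    BFF k l (fun f x => A f x + 1) := by
  have h : BFF k 2 (fun _ x => x 1 + 1) := by
    refine BFF.lrn (l := 1) (G := fun _ _ => 1) (H₁ := fun _ x => 2 * x 1 + 1)
      (H₂ := fun _ x => 2 * x 2)
      (K := fun _ x => 2 * x 1 + 1) _ (bff_one one_pos) (bff_s1 (bff_var _)) (bff_s0 (bff_var _))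
      (bff_s1 (bff_var _)) ?_ ?_ ?_ ?_
    · intro f x; simp [Fin.snoc]
    · intro f x y hy; simp [Fin.snoc]
    · intro f x y; simp [Fin.snoc]; omega
    · intro f x
      exact Nat.size_le_size (by omega)
  exact bff_comp2 h hA hA

theorem size_le_self' (n : ℕ) : Nat.size n ≤ n := Nat.size_le.2 Nat.lt_two_pow_self

/-- The binary length as a number. -/
theorem bff_len {k l : ℕ} {A : Fn k → Vc l → ℕ} (hA : BFF k l A) :
    BFF k l (fun f x => Nat.size (A f x)) := by
  have h : BFF k 2 (fun _ x => Nat.size (x 1)) := by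
    refine bff_iter0 (l := 1) (G := fun _ _ => 0) (S := fun _ x => x 2 + 1)
      (K := fun _ x => x 1) (bff_zero one_pos) (bff_succ (bff_var _)) (bff_var _)
      (fun _ _ n => n) ?_ ?_ ?_
    · intro f x; simp
    · intro f x y; simp [Fin.snoc]
    · intro f x y; simp [Fin.snoc]; exact Nat.size_le_size (size_le_self' y)
  exact bff_comp2 h hA hA

theorem bff_shift {k l : ℕ} {A B : Fn k → Vc l → ℕ} (hA : BFF k l A) (hB : BFF k l B) :
    BFF k l (fun f x => A f x / 2 ^ Nat.size (B f x)) := by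
  have h : BFF k 2 (fun _ x => x 0 / 2 ^ Nat.size (x 1)) := by
    refine bff_iter0 (l := 1) (G := fun _ x => x 0) (S := fun _ x => x 2 / 2)
      (K := fun _ x => x 0) (bff_var _) (bff_half (bff_var _)) (bff_var _)
      (fun _ x n => x 0 / 2 ^ n) ?_ ?_ ?_
    · intro f x; simp
    · intro f x y; simp [Fin.snoc, pow_succ, Nat.div_div_eq_div_mul]
    · intro f x y; simp [Fin.snoc]; exact Nat.size_le_size (Nat.div_le_self _ _)
  exact bff_comp2 h hA hB

theorem bp_sizeLE {k l : ℕ} {A B : Fn k → Vc l → ℕ} (hA : BFF k l A) (hB : BFF k l B) :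
    BP k l (fun f x => Nat.size (A f x) ≤ Nat.size (B f x)) :=
  bp_congr (bp_zero (bff_shift hA hB)) fun f x => by
    rw [Nat.size_le, Nat.div_eq_zero_iff]; simp

theorem bp_sizeLT {k l : ℕ} {A B : Fn k → Vc l → ℕ} (hA : BFF k l A) (hB : BFF k l B) :
    BP k l (fun f x => Nat.size (A f x) < Nat.size (B f x)) :=
  bp_congr (bp_not (bp_sizeLE hB hA)) fun f x => by simp

/-- Limited iteration. -/
theorem bff_iter {k l : ℕ} {G : Fn k → Vc l → ℕ} {S : Fn k → Vc (l + 2) → ℕ}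
    {K T : Fn k → Vc l → ℕ} (hG : BFF k l G) (hS : BFF k (l + 2) S) (hT : BFF k l T)
    (hK : BFF k l K)
    (R : Fn k → Vc l → ℕ → ℕ) (h0 : ∀ f x, R f x 0 = G f x)
    (h1 : ∀ f x y, R f x (Nat.size y + 1) = S f (sn (sn x y) (R f x (Nat.size y))))
    (hb : ∀ f x n, n ≤ Nat.size (T f x) → Nat.size (R f x n) ≤ Nat.size (K f x)) :
    BFF k l (fun f x => R f x (Nat.size (T f x))) := by
  classical
  let Q : Fn k → Vc l → ℕ → ℕ := fun f x n => if n ≤ Nat.size (T f x) then R f x n else 0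
  have hKi : BFF k (l + 2) (fun f z => K f (Fin.init (α := fun _ => ℕ)
      (Fin.init (α := fun _ => ℕ) z))) := bff_comp hK (sub_init sub_init')
  have hTi : BFF k (l + 2) (fun f z => T f (Fin.init (α := fun _ => ℕ)
      (Fin.init (α := fun _ => ℕ) z))) := bff_comp hT (sub_init sub_init')
  have hy : BFF k (l + 2) (fun _ z => z (Fin.last l).castSucc) := bff_var _
  have := bff_iter0 (K := fun f z => K f (Fin.init (α := fun _ => ℕ) z)) hG
    (bff_ite (bp_sizeLE (bff_s1 hy) hTi) hS (bff_zero (by omega)))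
    (bff_comp hK sub_init') Q
    (by intro f x; simp [Q, h0])
    (by
      intro f x y
      simp only [Q, size_s1, Fin.init_snoc, Fin.snoc_castSucc, Fin.snoc_last]
      by_cases h : Nat.size y + 1 ≤ Nat.size (T f x)
      · rw [if_pos h, if_pos h, if_pos (by omega), h1]
      · rw [if_neg h, if_neg h])
    (by
      intro f x y
      simp only [Q, Fin.init_snoc]
      split_ifs with h
      · exact hb f x _ h
      · simp)
  have h2 := bff_comp this (sub_snoc sub_id hT)
  exact bff_congr h2 (by intro f x; simp [Q])

theorem bp_eq {k l : ℕ} {A B : Fn k → Vc l → ℕ} (hA : BFF k l A) (hB : BFF k l B) :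
    BP k l (fun f x => A f x = B f x) := by
  classical
  have hl : BFF k (l + 2) (fun _ z => z (Fin.last (l + 1))) := bff_last
  have hy : BFF k (l + 2) (fun _ z => z (Fin.last l).castSucc) := bff_var _
  have hi := sub_init (sub_init' (k := k) (l := l + 1))
  have hAi := bff_comp hA hi
  have hBi := bff_comp hB hi
  -- S: keep 0 once failed; compare the bits
  have hp : BFF k l (fun f x => if (∀ i < Nat.size (big (A f x) (B f x)),
      A f x / 2 ^ i % 2 = B f x / 2 ^ i % 2) then 1 else 0) := by
    refine bff_iter (G := fun _ _ => 1) (K := fun _ _ => 1) (bff_one (bff_pos hA))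
      (bff_ite (bp_zero (bff_parity (bff_shift hAi hy)))
        (bff_ite (bp_zero (bff_parity (bff_shift hBi hy))) hl (bff_zero (by omega)))
        (bff_ite (bp_zero (bff_parity (bff_shift hBi hy))) (bff_zero (by omega)) hl))
      (bff_big hA hB) (bff_one (bff_pos hA))
      (fun f x n => if (∀ i < n, A f x / 2 ^ i % 2 = B f x / 2 ^ i % 2) then 1 else 0) ?_ ?_ ?_
    · intro f x; simp
    · intro f x y
      simp only [Fin.init_snoc, Fin.snoc_castSucc, Fin.snoc_last, Nat.lt_succ_iff_lt_or_eq,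
        or_imp, forall_and, forall_eq]
      have h1 := Nat.mod_two_eq_zero_or_one (A f x / 2 ^ Nat.size y)
      have h2 := Nat.mod_two_eq_zero_or_one (B f x / 2 ^ Nat.size y)
      rcases h1 with h1 | h1 <;> rcases h2 with h2 | h2 <;> simp [h1, h2]
    · intro f x n _
      split_ifs <;> simp
  refine bff_congr hp (fun f x => ?_)
  have : (∀ i < Nat.size (big (A f x) (B f x)),
      A f x / 2 ^ i % 2 = B f x / 2 ^ i % 2) ↔ A f x = B f x := by
    constructor
    · intro h
      apply Nat.eq_of_testBit_eq
      intro i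
      rw [Nat.testBit_eq_decide_div_mod_eq, Nat.testBit_eq_decide_div_mod_eq]
      by_cases hi : i < Nat.size (big (A f x) (B f x))
      · rw [h i hi]
      · have := size_big (A f x) (B f x)
        have h1 : A f x < 2 ^ i := Nat.size_le.1 (by omega)
        have h2 : B f x < 2 ^ i := Nat.size_le.1 (by omega)
        rw [Nat.div_eq_of_lt h1, Nat.div_eq_of_lt h2]
    · intro h; simp [h]
  simp only [this]
  congr

theorem size_mul_two_pow (n : ℕ) : Nat.size (2 ^ n) = n + 1 := Nat.size_pow

/-- Bounded search. -/
theorem bff_search {k l : ℕ} {p : Fn k → Vc l → ℕ → Prop} {T : Fn k → Vc l → ℕ}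
    (hT : BFF k l T)
    (hp : BP k (l + 1) (fun f y => p f (Fin.init (α := fun _ => ℕ) y) (Nat.size (y (Fin.last l))))) :
    ∃ W, BFF k l W ∧ ∀ f x, (∃ n < Nat.size (T f x), p f x n) → p f x (Nat.size (W f x)) := by
  classical
  let D : Fn k → Vc l → ℕ → ℕ := fun f x n =>
    Nat.rec 0 (fun n v => if p f x (Nat.size v) then v else 2 ^ n) n
  have hD1 : ∀ f x n, D f x (n + 1) = if p f x (Nat.size (D f x n)) then D f x n else 2 ^ n :=
    fun f x n => rfl
  have hsz : ∀ f x n, Nat.size (D f x n) ≤ n := by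
    intro f x n
    induction n with
    | zero => simp [D]
    | succ n ih =>
      rw [hD1]; split_ifs
      · omega
      · rw [Nat.size_pow]
  have hl : BFF k (l + 2) (fun _ z => z (Fin.last (l + 1))) := bff_last
  have hy : BFF k (l + 2) (fun _ z => z (Fin.last l).castSucc) := bff_var _
  refine ⟨fun f x => D f x (Nat.size (T f x)), ?_, ?_⟩
  · refine bff_iter (bff_zero (bff_pos hT))
      (bff_ite (bp_comp hp (sub_snoc (sub_init sub_init') hl)) hl
        (bff_smash hy (bff_one (by omega)))) hT hT D ?_ ?_ ?_
    · intro f x; rfl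
    · intro f x y
      simp [hD1, smash]
    · intro f x n hn
      exact (hsz f x n).trans hn
  · rintro f x ⟨n, hn, hpn⟩
    have : ∀ n, p f x (Nat.size (D f x n)) ∨ (Nat.size (D f x n) = n ∧ ∀ m < n, ¬ p f x m) := by
      intro n
      induction n with
      | zero => right; simp [D]
      | succ n ih =>
        rw [hD1]
        split_ifs with h
        · exact Or.inl h
        · right
          rcases ih with ih | ⟨ih1, ih2⟩
          · exact absurd ih h
          · refine ⟨Nat.size_pow, fun m hm => ?_⟩
            rcases Nat.lt_succ_iff_lt_or_eq.1 hm with hm | rfl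
            · exact ih2 m hm
            · rwa [ih1] at h
    rcases this (Nat.size (T f x)) with h | h
    · exact h
    · exact absurd hpn (h.2 n hn)

/-- left part of an environment -/
def lft (p l : ℕ) (w : Vc (p + l)) : Vc p := fun i => w (Fin.castAdd l i)
/-- right part of an environment -/
def rgt (p l : ℕ) (w : Vc (p + l)) : Vc l := fun i => w (Fin.natAdd p i)

theorem lft_snoc (p l : ℕ) (w : Vc (p + l)) (y : ℕ) : lft p (l + 1) (sn w y) = lft p l w := by
  funext i
  exact Fin.snoc_castSucc (α := fun _ => ℕ) y w (Fin.castAdd l i)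

theorem rgt_snoc (p l : ℕ) (w : Vc (p + l)) (y : ℕ) :
    rgt p (l + 1) (sn w y) = sn (rgt p l w) y := by
  funext i
  refine Fin.lastCases ?_ (fun i => ?_) i
  · rw [Fin.snoc_last]
    exact Fin.snoc_last (α := fun _ => ℕ) y w
  · rw [Fin.snoc_castSucc]
    exact Fin.snoc_castSucc (α := fun _ => ℕ) y w (Fin.natAdd p i)

theorem sub_lft {k p l : ℕ} : Sub k (p + l) p (fun _ w => lft p l w) := fun _ => bff_var _
theorem sub_rgt {k p l : ℕ} : Sub k (p + l) l (fun _ w => rgt p l w) := fun _ => bff_var _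

theorem lft_append (p l : ℕ) (u : Vc p) (x : Vc l) : lft p l (Fin.append u x) = u := by
  funext i; simp [lft]
theorem rgt_append (p l : ℕ) (u : Vc p) (x : Vc l) : rgt p l (Fin.append u x) = x := by
  funext i; simp [rgt]

theorem sub_append {k m p l : ℕ} {A : Fn k → Vc m → Vc p} {B : Fn k → Vc m → Vc l}
    (hA : Sub k m p A) (hB : Sub k m l B) :
    Sub k m (p + l) (fun f x => Fin.append (A f x) (B f x)) := by
  intro i
  refine Fin.addCases (fun i => ?_) (fun i => ?_) i
  · simpa using hA i
  · simpa using hB i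

/-- Closure under functional substitution. -/
theorem bff_subst {k l : ℕ} {F : Fn k → Vc l → ℕ} (hF : BFF k l F) :
    ∀ {k' p : ℕ} (T : Fin k → Fn k' → Vc (p + 1) → ℕ) (_ : ∀ i, BFF k' (p + 1) (T i)),
      BFF k' (p + l) (fun f w => F (fun i z => T i f (sn (lft p l w) z)) (rgt p l w)) := by
  induction hF with
  | zero => intro k' p T hT; exact bff_zero (by omega)
  | s0 => intro k' p T hT; exact bff_s0 (bff_var _)
  | s1 => intro k' p T hT; exact bff_s1 (bff_var _)
  | proj n i => intro k' p T hT; exact bff_var _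
  | smashF => intro k' p T hT; exact bff_smash (bff_var _) (bff_var _)
  | ap => intro k' p T hT; exact bff_comp (hT 0) (sub_snoc sub_lft (bff_var _))
  | @expansion k l k₂ l₂ ρ σ hρ hσ G hG ih =>
    intro k' p T hT
    have := bff_comp (ih (fun i => T (ρ i)) (fun i => hT _))
      (sub_append (sub_lft (p := p) (l := l₂))
        (B := fun _ w j => rgt p l₂ w (σ j)) (fun j => bff_var _))
    simpa only [lft_append, rgt_append] using this
  | @comp k l m H G hH hG ih1 ih2 =>
    intro k' p T hT
    have := bff_comp (ih1 T hT)
      (sub_append (sub_lft (p := p) (l := l))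
        (sub_append (A := fun f w i => G i (fun i z => T i f (sn (lft p l w) z)) (rgt p l w))
          (fun i => ih2 i T hT) sub_rgt))
    simpa only [lft_append, rgt_append] using this
  | @lrn k l F G H₁ H₂ K hG hH₁ hH₂ hK hbase heven hodd hbound ihG ih1 ih2 ihK =>
    intro k' p T hT
    refine BFF.lrn (l := p + l) _ (ihG T hT) (ih1 T hT) (ih2 T hT) (ihK T hT) ?_ ?_ ?_ ?_
    · intro f w; simp only [lft_snoc, rgt_snoc]; exact hbase _ _
    · intro f w y hy; simp only [lft_snoc, rgt_snoc]; exact heven _ _ _ hy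
    · intro f w y; simp only [lft_snoc, rgt_snoc]; exact hodd _ _ _
    · intro f w; exact hbound _ _

/-- If two function arguments give different values, a point where the functions differ can be
found feasibly. -/
theorem bff_witness {k l : ℕ} {F : Fn k → Vc l → ℕ} (hF : BFF k l F) :
    ∀ {k' p : ℕ} (T T' : Fin k → Fn k' → Vc (p + 1) → ℕ) (_ : ∀ i, BFF k' (p + 1) (T i))
      (_ : ∀ i, BFF k' (p + 1) (T' i)),
      ∃ W, BFF k' (p + l) W ∧ ∀ f w,
        F (fun i z => T i f (sn (lft p l w) z)) (rgt p l w) ≠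
          F (fun i z => T' i f (sn (lft p l w) z)) (rgt p l w) →
        ∃ i, T i f (sn (lft p l w) (W f w)) ≠ T' i f (sn (lft p l w) (W f w)) := by
  induction hF with
  | zero => intro k' p T T' hT hT'; exact ⟨_, bff_zero (by omega), fun f w h => absurd rfl h⟩
  | s0 => intro k' p T T' hT hT'; exact ⟨_, bff_zero (by omega), fun f w h => absurd rfl h⟩
  | s1 => intro k' p T T' hT hT'; exact ⟨_, bff_zero (by omega), fun f w h => absurd rfl h⟩
  | proj n i =>
    intro k' p T T' hT hT'
    exact ⟨_, bff_zero (by have := i.pos; omega), fun f w h => absurd rfl h⟩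
  | smashF => intro k' p T T' hT hT'; exact ⟨_, bff_zero (by omega), fun f w h => absurd rfl h⟩
  | ap =>
    intro k' p T T' hT hT'
    exact ⟨fun f w => rgt p 1 w 0, bff_var _, fun f w h => ⟨0, h⟩⟩
  | @expansion k l k₂ l₂ ρ σ hρ hσ G hG ih =>
    intro k' p T T' hT hT'
    obtain ⟨W, hW, h⟩ := ih (fun i => T (ρ i)) (fun i => T' (ρ i)) (fun i => hT _) (fun i => hT' _)
    refine ⟨_, bff_comp hW (sub_append (sub_lft (p := p) (l := l₂))
        (B := fun _ w j => rgt p l₂ w (σ j)) (fun j => bff_var _)), ?_⟩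
    intro f w hne
    have := h f (Fin.append (lft p l₂ w) (fun j => rgt p l₂ w (σ j)))
    simp only [lft_append, rgt_append] at this
    obtain ⟨i, hi⟩ := this hne
    exact ⟨ρ i, hi⟩
  | @comp k l m H G hH hG ih1 ih2 =>
    intro k' p T T' hT hT'
    classical
    obtain ⟨WH, hWH, hH'⟩ := ih1 T T' hT hT'
    choose WG hWG hG' using fun i => ih2 i T T' hT hT'
    let GT : Fn k' → Vc (p + l) → Vc m :=
      fun f w i => G i (fun i z => T i f (sn (lft p l w) z)) (rgt p l w)
    let GT' : Fn k' → Vc (p + l) → Vc m :=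
      fun f w i => G i (fun i z => T' i f (sn (lft p l w) z)) (rgt p l w)
    have hGT : Sub k' (p + l) m GT := fun i => bff_subst (hG i) T hT
    have hGT' : Sub k' (p + l) m GT' := fun i => bff_subst (hG i) T' hT'
    let A : Fn k' → Vc (p + l) → Vc (p + (m + l)) := fun f w =>
      Fin.append (lft p l w) (Fin.append (GT f w) (rgt p l w))
    have hA : Sub k' (p + l) (p + (m + l)) A := sub_append sub_lft (sub_append hGT sub_rgt)
    -- treat the arguments one at a time
    have key : ∀ n ≤ m, ∃ W, BFF k' (p + l) W ∧ ∀ f w,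
        ((∃ i : Fin m, i.1 < n ∧ GT f w i ≠ GT' f w i) →
          ∃ i, T i f (sn (lft p l w) (W f w)) ≠ T' i f (sn (lft p l w) (W f w))) ∧
        ((∀ i : Fin m, i.1 < n → GT f w i = GT' f w i) → W f w = WH f (A f w)) := by
      intro n
      induction n with
      | zero =>
        intro _
        refine ⟨_, bff_comp hWH hA, fun f w => ⟨?_, fun _ => rfl⟩⟩
        rintro ⟨i, hi, _⟩; omega
      | succ n ih =>
        intro hn
        obtain ⟨W, hW, h⟩ := ih (by omega)
        refine ⟨_, bff_ite (bp_eq (hGT ⟨n, hn⟩) (hGT' ⟨n, hn⟩)) hW (hWG ⟨n, hn⟩), ?_⟩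
        intro f w
        by_cases hc : GT f w ⟨n, hn⟩ = GT' f w ⟨n, hn⟩
        · simp only [hc, if_true]
          refine ⟨?_, fun hall => (h f w).2 (fun i hi => hall i (by omega))⟩
          rintro ⟨i, hi, hne⟩
          refine (h f w).1 ⟨i, ?_, hne⟩
          rcases Nat.lt_succ_iff_lt_or_eq.1 hi with h' | h'
          · exact h'
          · exact absurd (by subst h'; exact hc) hne
        · simp only [hc, if_false]
          refine ⟨fun _ => hG' ⟨n, hn⟩ f w hc, fun hall => absurd (hall ⟨n, hn⟩ (by simp)) hc⟩
    obtain ⟨W, hW, h⟩ := key m le_rfl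
    refine ⟨W, hW, fun f w hne => ?_⟩
    by_cases hall : ∀ i : Fin m, GT f w i = GT' f w i
    · rw [(h f w).2 (fun i _ => hall i)]
      have h1 := hH' f (A f w)
      simp only [A, lft_append, rgt_append] at h1
      apply h1
      have e : GT f w = GT' f w := funext hall
      intro h2
      apply hne
      refine h2.trans ?_
      rw [e]
    · push Not at hall
      obtain ⟨i, hi⟩ := hall
      exact (h f w).1 ⟨i, i.2, hi⟩
  | @lrn k l F G H₁ H₂ K hG hH₁ hH₂ hK hbase heven hodd hbound ihG ih1 ih2 ihK =>
    intro k' p T T' hT hT'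
    classical
    obtain ⟨WG, hWG, hG'⟩ := ihG T T' hT hT'
    obtain ⟨W1, hW1, h1'⟩ := ih1 T T' hT hT'
    obtain ⟨W2, hW2, h2'⟩ := ih2 T T' hT hT'
    have hFB : BFF k (l + 1) F := BFF.lrn F hG hH₁ hH₂ hK hbase heven hodd hbound
    let FT : Fn k' → Vc (p + l + 1) → ℕ :=
      fun f w => F (fun i z => T i f (sn (lft p (l + 1) w) z)) (rgt p (l + 1) w)
    let FT' : Fn k' → Vc (p + l + 1) → ℕ :=
      fun f w => F (fun i z => T' i f (sn (lft p (l + 1) w) z)) (rgt p (l + 1) w)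
    have hFT : BFF k' (p + l + 1) FT := bff_subst hFB T hT
    have hFT' : BFF k' (p + l + 1) FT' := bff_subst hFB T' hT'
    -- the first prefix at which the values differ
    let D : Fn k' → Vc (p + l) → ℕ → ℕ := fun f x y =>
      Nat.binaryRec (motive := fun _ => ℕ) 0
        (fun b y v => if FT f (sn x y) = FT' f (sn x y) then Nat.bit b y else v) y
    have hD0 : ∀ f x, D f x 0 = 0 := fun f x => Nat.binaryRec_zero _ _
    have hDb : ∀ f x b y, (y = 0 → b = true) → D f x (Nat.bit b y) =
        if FT f (sn x y) = FT' f (sn x y) then Nat.bit b y else D f x y := by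
      intro f x b y h
      exact Nat.binaryRec_eq _ _ (Or.inr h)
    have hDe : ∀ f x y, 0 < y → D f x (2 * y) =
        if FT f (sn x y) = FT' f (sn x y) then 2 * y else D f x y := by
      intro f x y h
      exact hDb f x false y (by omega)
    have hDo : ∀ f x y, D f x (2 * y + 1) =
        if FT f (sn x y) = FT' f (sn x y) then 2 * y + 1 else D f x y := by
      intro f x y
      exact hDb f x true y (by simp)
    have hDle : ∀ f x y, D f x y ≤ y := by
      intro f x y
      induction y using Nat.strong_induction_on with
      | _ y ih =>
        rcases Nat.eq_zero_or_pos y with h | h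
        · subst h; simp [hD0]
        · rcases Nat.even_or_odd' y with ⟨c, hc | hc⟩
          · rw [hc, hDe _ _ _ (by omega)]
            have := ih c (by omega)
            split_ifs <;> omega
          · rw [hc, hDo]
            have := ih c (by omega)
            split_ifs <;> omega
    have hDprop : ∀ f x y, FT f (sn x y) ≠ FT' f (sn x y) →
        FT f (sn x (D f x y)) ≠ FT' f (sn x (D f x y)) ∧
        (D f x y ≠ 0 → FT f (sn x (D f x y / 2)) = FT' f (sn x (D f x y / 2))) := by
      intro f x y
      induction y using Nat.strong_induction_on with
      | _ y ih =>
        intro hne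
        rcases Nat.eq_zero_or_pos y with h | h
        · subst h; rw [hD0]; exact ⟨hne, fun h => absurd rfl h⟩
        · rcases Nat.even_or_odd' y with ⟨c, hc | hc⟩
          · rw [hc, hDe _ _ _ (by omega)]
            split_ifs with hs
            · refine ⟨hc ▸ hne, fun _ => ?_⟩
              rwa [show 2 * c / 2 = c by omega]
            · exact ih c (by omega) hs
          · rw [hc, hDo]
            split_ifs with hs
            · refine ⟨hc ▸ hne, fun _ => ?_⟩
              rwa [show (2 * c + 1) / 2 = c by omega]
            · exact ih c (by omega) hs
    have hl : BFF k' (p + l + 2) (fun _ z => z (Fin.last (p + l + 1))) := bff_last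
    have hy : BFF k' (p + l + 2) (fun _ z => z (Fin.last (p + l)).castSucc) := bff_var _
    have hD : BFF k' (p + l + 1) (fun f w =>
        D f (Fin.init (α := fun _ => ℕ) w) (w (Fin.last (p + l)))) := by
      have hE : BP k' (p + l + 2) (fun f z => FT f (Fin.init (α := fun _ => ℕ) z)
          = FT' f (Fin.init (α := fun _ => ℕ) z)) :=
        bp_eq (bff_comp hFT sub_init') (bff_comp hFT' sub_init')
      refine BFF.lrn (l := p + l) _ (bff_zero (k := k') (l := p + l)
        (by have := bff_pos hG; omega)) (bff_ite hE (bff_s0 hy) hl) (bff_ite hE (bff_s1 hy) hl)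
        (bff_last) ?_ ?_ ?_ ?_
      · intro f x; simp [hD0]
      · intro f x y h; simp [hDe _ _ _ h]
      · intro f x y; simp [hDo]
      · intro f x; exact Nat.size_le_size (hDle _ _ _)
    -- assemble
    let Dw : Fn k' → Vc (p + l + 1) → ℕ := fun f w =>
        D f (Fin.init (α := fun _ => ℕ) w) (w (Fin.last (p + l)))
    have hDw : BFF k' (p + l + 1) Dw := hD
    let E : Fn k' → Vc (p + l + 1) → Vc (p + l + 1) := fun f w =>
      sn (Fin.init (α := fun _ => ℕ) w) (Dw f w / 2)
    have hEs : Sub k' (p + l + 1) (p + l + 1) E := sub_snoc sub_init' (bff_half hDw)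
    have hE2 : Sub k' (p + l + 1) (p + l + 2) (fun f w => sn (E f w) (FT f (E f w))) :=
      sub_snoc hEs (bff_comp hFT hEs)
    refine ⟨_, bff_ite (bp_zero hDw) (bff_comp hWG sub_init')
      (bff_ite (bp_zero (bff_parity hDw)) (bff_comp hW1 hE2) (bff_comp hW2 hE2)), ?_⟩
    intro f w hne
    obtain ⟨x, y, rfl⟩ : ∃ (x : Vc (p + l)) (y : ℕ), w = sn x y :=
      ⟨Fin.init w, w (Fin.last _), (Fin.snoc_init_self (α := fun _ => ℕ) w).symm⟩
    have hp := hDprop f x y hne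
    have hDwe : Dw f (sn x y) = D f x y := by simp [Dw]
    have hEe : E f (sn x y) = sn x (D f x y / 2) := by simp [E, hDwe]
    simp only [hDwe, hEe, Fin.init_snoc]
    generalize D f x y = d at hp
    obtain ⟨hp1, hp2⟩ := hp
    simp only [lft_snoc]
    by_cases hd : d = 0
    · subst hd
      simp only [if_true]
      apply hG' f x
      simp only [FT, FT', lft_snoc, rgt_snoc] at hp1
      rwa [hbase, hbase] at hp1
    · simp only [hd, if_false]
      have hag := hp2 hd
      by_cases hpar : d % 2 = 0
      · simp only [hpar, if_true]
        have h := h1' f (sn (sn x (d / 2)) (FT f (sn x (d / 2))))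
        simp only [lft_snoc, rgt_snoc] at h
        apply h
        obtain ⟨c, rfl⟩ : ∃ c, d = 2 * c := ⟨d / 2, by omega⟩
        rw [show 2 * c / 2 = c by omega] at hag ⊢
        simp only [FT, FT', lft_snoc, rgt_snoc] at hp1 hag ⊢
        have hc : 0 < c := Nat.pos_of_ne_zero (by rintro rfl; exact hd rfl)
        rw [heven _ _ _ hc, heven _ _ _ hc] at hp1
        rw [← hag] at hp1
        exact hp1
      · simp only [hpar, if_false]
        have h := h2' f (sn (sn x (d / 2)) (FT f (sn x (d / 2))))
        simp only [lft_snoc, rgt_snoc] at h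
        apply h
        obtain ⟨c, rfl⟩ : ∃ c, d = 2 * c + 1 := ⟨d / 2, by omega⟩
        rw [show (2 * c + 1) / 2 = c by omega] at hag ⊢
        simp only [FT, FT', lft_snoc, rgt_snoc] at hp1 hag ⊢
        rw [hodd, hodd] at hp1
        rw [← hag] at hp1
        exact hp1

/-- One level of the search for large answers: `q` can be found feasibly such that the query
`Z(f,x,q)` does not have a substantially longer answer than `q`. -/
theorem bff_level {l : ℕ} {N : Fn 1 → Vc l → ℕ} {Z : Fn 1 → Vc (l + 1) → ℕ}
    (hN : BFF 1 l N) (hZ : BFF 1 (l + 1) Z) :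
    ∃ q, BFF 1 l q ∧ ∀ f x, ¬ (Nat.size (Z f (sn x (q f x))) ≤ Nat.size (N f x) ∧
      Nat.size (smash (f 0 (q f x)) 2) < Nat.size (f 0 (Z f (sn x (q f x))))) := by
  classical
  let br : Fn 1 → Vc (l + 1) → Prop := fun f y =>
    Nat.size (Z f y) ≤ Nat.size (N f (Fin.init (α := fun _ => ℕ) y)) ∧
      Nat.size (smash (f 0 (y (Fin.last l))) 2) < Nat.size (f 0 (Z f y))
  have hbr : BP 1 (l + 1) br := bp_and (bp_sizeLE hZ (bff_comp hN sub_init'))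
    (bp_sizeLT (bff_smash (bff_ap 0 bff_last) (bff_two (by omega))) (bff_ap 0 hZ))
  have hbr' : ∀ f x q, br f (sn x q) ↔ (Nat.size (Z f (sn x q)) ≤ Nat.size (N f x) ∧
      2 * Nat.size (f 0 q) + 1 < Nat.size (f 0 (Z f (sn x q)))) := by
    intro f x q
    have : Nat.size 2 = 2 := by decide
    simp [br, size_smash, this, mul_comm]
  have hl : BFF 1 (l + 2) (fun _ z => z (Fin.last (l + 1))) := bff_last
  have hy : BFF 1 (l + 2) (fun _ z => z (Fin.last l).castSucc) := bff_var _
  have hpos := bff_pos hN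
  -- iterate
  let R : Fn 1 → Vc l → ℕ → ℕ := fun f x n =>
    Nat.rec 0 (fun _ v => if br f (sn x v) then Z f (sn x v) else v) n
  have hR1 : ∀ f x n, R f x (n + 1) =
      if br f (sn x (R f x n)) then Z f (sn x (R f x n)) else R f x n := fun f x n => rfl
  have hRb : ∀ f x n, Nat.size (R f x n) ≤ Nat.size (N f x) := by
    intro f x n
    induction n with
    | zero => simp [R]
    | succ n ih =>
      rw [hR1]; split_ifs with h
      · exact ((hbr' _ _ _).1 h).1
      · exact ih
  have hii := sub_init (sub_init' (k := 1) (l := l + 1))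
  have hsub : Sub 1 (l + 2) (l + 1) (fun _ z => sn (Fin.init (α := fun _ => ℕ)
      (Fin.init (α := fun _ => ℕ) z)) (z (Fin.last (l + 1)))) := sub_snoc hii hl
  let q1 : Fn 1 → Vc l → ℕ := fun f x => R f x (Nat.size (2 * N f x + 1))
  have hq1 : BFF 1 l q1 := by
    refine bff_iter (bff_zero hpos)
      (bff_ite (bp_comp hbr hsub) (bff_comp hZ hsub) hl) (bff_s1 hN) hN R ?_ ?_ ?_
    · intro f x; rfl
    · intro f x y; simp [hR1]
    · intro f x n _; exact hRb f x n
  have hgrow : ∀ f x n, br f (sn x (R f x n)) → 2 ^ n ≤ Nat.size (f 0 (R f x n)) + 1 := by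
    intro f x n
    induction n with
    | zero => intro _; simp
    | succ n ih =>
      intro h
      by_cases hb : br f (sn x (R f x n))
      · have h1 := ih hb
        have h2 := ((hbr' _ _ _).1 hb).2
        rw [hR1, if_pos hb, pow_succ]; omega
      · have : R f x (n + 1) = R f x n := by rw [hR1, if_neg hb]
        rw [this] at h; exact absurd h hb
  -- scan
  let A : Fn 1 → Vc l → ℕ → ℕ := fun f x n =>
    Nat.rec 0 (fun n v => if Nat.size n ≤ Nat.size (N f x) ∧
      Nat.size (f 0 v) < Nat.size (f 0 n) then n else v) n
  have hA1 : ∀ f x n, A f x (n + 1) = if Nat.size n ≤ Nat.size (N f x) ∧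
      Nat.size (f 0 (A f x n)) < Nat.size (f 0 n) then n else A f x n := fun f x n => rfl
  have hAb : ∀ f x n, Nat.size (A f x n) ≤ Nat.size (N f x) := by
    intro f x n
    induction n with
    | zero => simp [A]
    | succ n ih =>
      rw [hA1]; split_ifs with h
      · exact h.1
      · exact ih
  have hAmax : ∀ f x n m, m < n → Nat.size m ≤ Nat.size (N f x) →
      Nat.size (f 0 m) ≤ Nat.size (f 0 (A f x n)) := by
    intro f x n
    induction n with
    | zero => intro m hm; omega
    | succ n ih =>
      intro m hm hs
      rw [hA1]
      rcases Nat.lt_succ_iff_lt_or_eq.1 hm with hm | rfl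
      · have := ih m hm hs
        split_ifs with h
        · omega
        · exact this
      · split_ifs with h
        · exact le_rfl
        · push Not at h; exact h hs
  let q2 : Fn 1 → Vc l → ℕ := fun f x => A f x (Nat.size (f 0 (q1 f x)))
  have hq2 : BFF 1 l q2 := by
    refine bff_iter (bff_zero hpos)
      (bff_ite (bp_and (bp_sizeLE (bff_len hy) (bff_comp hN hii))
        (bp_sizeLT (bff_ap 0 hl) (bff_ap 0 (bff_len hy)))) (bff_len hy) hl)
      (bff_ap 0 hq1) hN A ?_ ?_ ?_
    · intro f x; rfl
    · intro f x y; simp [hA1]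
    · intro f x n _; exact hAb f x n
  refine ⟨_, bff_ite (bp_comp hbr (sub_snoc sub_id hq1)) hq2 hq1, fun f x => ?_⟩
  by_cases h : br f (sn x (q1 f x))
  · simp only [h, if_true]
    rintro ⟨h1, h2⟩
    have hg := hgrow f x _ h
    rw [size_s1, pow_succ] at hg
    have hlt : Z f (sn x (q2 f x)) < 2 ^ Nat.size (N f x) := Nat.size_le.1 h1
    have h3 := hAmax f x (Nat.size (f 0 (q1 f x))) (Z f (sn x (q2 f x))) (by
      have : Nat.size (f 0 (R f x (Nat.size (N f x) + 1))) = Nat.size (f 0 (q1 f x)) := by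
        simp only [q1, size_s1]
      have := Nat.one_le_two_pow (n := Nat.size (N f x))
      omega) h1
    have : Nat.size 2 = 2 := by decide
    rw [size_smash, this] at h2
    change _ ≤ Nat.size (f 0 (q2 f x)) at h3
    omega
  · simp only [h, if_false]
    simpa [br] using h

/-- The iterated bounds `n ↦ n² + 1 + |f|(n)`. -/
def chain {l : ℕ} (f : Fn 1) (x : Vc l) : ℕ → ℕ
  | 0 => 2 + ∑ j, Nat.size (x j)
  | d + 1 => chain f x d * chain f x d + 1 + fnorm (f 0) (chain f x d)

theorem chain_ge_two {l : ℕ} (f : Fn 1) (x : Vc l) (d : ℕ) : 2 ≤ chain f x d := by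
  induction d with
  | zero => simp [chain]
  | succ d ih => simp only [chain]; nlinarith

theorem chain_lt {l : ℕ} (f : Fn 1) (x : Vc l) (d : ℕ) : chain f x d < chain f x (d + 1) := by
  have := chain_ge_two f x d
  simp only [chain]; nlinarith

theorem chain_mono {l : ℕ} (f : Fn 1) (x : Vc l) : Monotone (chain f x) :=
  monotone_nat_of_le_succ fun d => (chain_lt f x d).le

theorem le_chain {l : ℕ} (f : Fn 1) (x : Vc l) (d : ℕ) : d ≤ chain f x d := by
  induction d with
  | zero => omega
  | succ d ih => have := chain_lt f x d; omega

theorem fnorm_mono (f : ℕ → ℕ) {m n : ℕ} (h : m ≤ n) : fnorm f m ≤ fnorm f n := by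
  unfold fnorm
  refine Finset.sup_mono ?_
  intro z
  simp only [Finset.mem_range]
  intro hz
  exact hz.trans_le (Nat.pow_le_pow_right (by omega) h)

theorem poly_le_chain {l : ℕ} (P : SOPoly 1 l) : ∃ d, ∀ f x, P.eval f x ≤ chain f x d := by
  induction P with
  | const n => exact ⟨n, fun f x => le_chain f x n⟩
  | len j =>
    refine ⟨0, fun f x => ?_⟩
    have := Finset.single_le_sum (f := fun j => Nat.size (x j)) (fun i _ => Nat.zero_le _)
      (Finset.mem_univ j)
    simp only [chain, SOPoly.eval]; omega
  | add p q ihp ihq =>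
    obtain ⟨d, hd⟩ := ihp
    obtain ⟨e, he⟩ := ihq
    refine ⟨max d e + 1, fun f x => ?_⟩
    have h1 := (hd f x).trans (chain_mono f x (le_max_left d e))
    have h2 := (he f x).trans (chain_mono f x (le_max_right d e))
    have h3 := chain_ge_two f x (max d e)
    simp only [chain, SOPoly.eval]; nlinarith
  | mul p q ihp ihq =>
    obtain ⟨d, hd⟩ := ihp
    obtain ⟨e, he⟩ := ihq
    refine ⟨max d e + 1, fun f x => ?_⟩
    have h1 := (hd f x).trans (chain_mono f x (le_max_left d e))
    have h2 := (he f x).trans (chain_mono f x (le_max_right d e))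
    have h3 := Nat.mul_le_mul h1 h2
    simp only [chain, SOPoly.eval]; omega
  | app i p ihp =>
    obtain ⟨d, hd⟩ := ihp
    refine ⟨d + 1, fun f x => ?_⟩
    have h1 := fnorm_mono (f 0) (hd f x)
    have : i = 0 := Subsingleton.elim _ _
    subst this
    simp only [chain, SOPoly.eval]; omega

/-- A number at least as long as the sum of the lengths of the arguments. -/
theorem exists_base {l : ℕ} (hl : 0 < l) :
    ∃ B, BFF 1 l B ∧ ∀ f x, 2 + ∑ j, Nat.size (x j) ≤ Nat.size (B f x) := by
  have : ∀ s : Finset (Fin l), ∃ B, BFF 1 l B ∧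
      ∀ f x, 2 + ∑ j ∈ s, Nat.size (x j) ≤ Nat.size (B f x) := by
    intro s
    induction s using Finset.induction_on with
    | empty => exact ⟨_, bff_two hl, fun f x => by simp; decide⟩
    | insert a s ha ih =>
      obtain ⟨B, hB, h⟩ := ih
      refine ⟨_, bff_big (bff_var a) hB, fun f x => ?_⟩
      have h1 := size_big (x a) (B f x)
      have h2 := h f x
      rw [Finset.sum_insert ha]; omega
  exact this Finset.univ

/-- The length bounds obtained from candidate queries. -/
def NN {l : ℕ} (B : Fn 1 → Vc l → ℕ) : (d : ℕ) → Fn 1 → Vc (l + d) → ℕ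
  | 0, f, y => B f y
  | d + 1, f, y => big (smash (NN B d f (Fin.init (α := fun _ => ℕ) y))
      (NN B d f (Fin.init (α := fun _ => ℕ) y))) (smash (f 0 (y (Fin.last (l + d)))) 2)

/-- `z` is a query whose answer is much longer than that of one of the candidates. -/
def RR {l : ℕ} (B : Fn 1 → Vc l → ℕ) : (d : ℕ) → Fn 1 → Vc (l + d) → ℕ → Prop
  | 0, _, _, _ => False
  | d + 1, f, y, z => RR B d f (Fin.init (α := fun _ => ℕ) y) z ∨
      (Nat.size z ≤ Nat.size (NN B d f (Fin.init (α := fun _ => ℕ) y)) ∧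
        Nat.size (smash (f 0 (y (Fin.last (l + d)))) 2) < Nat.size (f 0 z))

theorem bff_NN {l : ℕ} {B : Fn 1 → Vc l → ℕ} (hB : BFF 1 l B) (d : ℕ) :
    BFF 1 (l + d) (NN B d) := by
  induction d with
  | zero => exact hB
  | succ d ih =>
    have h := bff_comp ih (sub_init' (k := 1) (l := l + d))
    exact bff_big (bff_smash h h) (bff_smash (bff_ap 0 bff_last) (bff_two (by omega)))

theorem bp_RR {l : ℕ} {B : Fn 1 → Vc l → ℕ} (hB : BFF 1 l B) (d : ℕ) :
    BP 1 (l + d + 1) (fun f w => RR B d f (Fin.init (α := fun _ => ℕ) w) (w (Fin.last _))) := by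
  classical
  induction d with
  | zero => exact bff_congr (bff_zero (by omega)) (fun f x => by simp [RR])
  | succ d ih =>
    have hl : BFF 1 (l + d + 2) (fun _ z => z (Fin.last (l + d + 1))) := bff_last
    have hy : BFF 1 (l + d + 2) (fun _ z => z (Fin.last (l + d)).castSucc) := bff_var _
    have hii := sub_init (sub_init' (k := 1) (l := l + d + 1))
    have h1 := bp_comp ih (sub_snoc hii hl)
    have h2 := bp_and (bp_sizeLE hl (bff_comp (bff_NN hB d) hii))
      (bp_sizeLT (bff_smash (bff_ap 0 hy) (bff_two (by omega))) (bff_ap 0 hl))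
    refine bp_congr (bp_or h1 h2) (fun f w => ?_)
    simp only [Fin.init_snoc, Fin.snoc_last]
    rfl

theorem chain_le_NN {l : ℕ} {B : Fn 1 → Vc l → ℕ}
    (hB : ∀ f x, 2 + ∑ j, Nat.size (x j) ≤ Nat.size (B f x)) (f f' : Fn 1) (d : ℕ)
    (y : Vc (l + d)) (h : ∀ z, f' 0 z = 0 ∨ (f' 0 z = f 0 z ∧ ¬ RR B d f y z)) :
    chain f' (lft l d y) d ≤ Nat.size (NN B d f y) := by
  induction d with
  | zero => exact hB f y
  | succ d ih =>
    have h1 := ih (Fin.init (α := fun _ => ℕ) y) (fun z => by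
      rcases h z with h | ⟨h, h'⟩
      · exact Or.inl h
      · exact Or.inr ⟨h, fun h'' => h' (Or.inl h'')⟩)
    change chain f' (lft l (d + 1) y) d ≤ _ at h1
    have h2 : fnorm (f' 0) (chain f' (lft l (d + 1) y) d) ≤
        Nat.size (smash (f 0 (y (Fin.last (l + d)))) 2) := by
      refine (fnorm_mono _ h1).trans ?_
      unfold fnorm
      refine Finset.sup_le fun z hz => ?_
      rw [Finset.mem_range] at hz
      rcases h z with h | ⟨h, h'⟩
      · simp [h]
      · rw [h]
        by_contra hc
        exact h' (Or.inr ⟨Nat.size_le.2 hz, by omega⟩)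
    simp only [chain, NN]
    refine le_trans ?_ (size_big _ _)
    rw [size_smash (NN B d f _)]
    have := Nat.mul_le_mul h1 h1
    omega

end BFFProof

open BFFProof in
/-- If `F(f,x⃗) = F*(f,x⃗,P(|f|,|x⃗|))` is defined from basic feasible functionals `G(f,x⃗)`
and `H(f,x⃗,z,y)` by polynomially bounded recursion of polynomial length with second-order
polynomial bounds `(Q,P)` — i.e. `F*(f,x⃗,0) = G(f,x⃗)`, `F*(f,x⃗,y+1) = H(f,x⃗,F*(f,x⃗,y),y)`,
`|F*(f,x⃗,y)| ≤ Q(|f|,|x⃗|)` for all `y ≤ P(|f|,|x⃗|)`, `F*(f,x⃗,y) = F*(f,x⃗,P(|f|,|x⃗|))`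
for all `y ≥ P(|f|,|x⃗|)`, together with the stability condition — then `F` is a basic
feasible functional. -/
theorem bff_of_polynomially_bounded_recursion_of_polynomial_length (l : ℕ)
    (P Q : SOPoly 1 l)
    (G : (Fin 1 → ℕ → ℕ) → (Fin l → ℕ) → ℕ)
    (H : (Fin 1 → ℕ → ℕ) → (Fin (l + 2) → ℕ) → ℕ)
    (Fs : (Fin 1 → ℕ → ℕ) → (Fin (l + 1) → ℕ) → ℕ)
    (hG : BFF 1 l G) (hH : BFF 1 (l + 2) H)
    (hbase : ∀ f x, Fs f (Fin.snoc x 0) = G f x)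
    (hrec : ∀ f x y, Fs f (Fin.snoc x (y + 1)) =
      H f (Fin.snoc (Fin.snoc x (Fs f (Fin.snoc x y))) y))
    (hbound : ∀ f x y, y ≤ P.eval f x → Nat.size (Fs f (Fin.snoc x y)) ≤ Q.eval f x)
    (hstable : ∀ f x y, P.eval f x ≤ y →
      Fs f (Fin.snoc x y) = Fs f (Fin.snoc x (P.eval f x)))
    (hagree : ∀ (x : Fin l → ℕ) (f f' : Fin 1 → ℕ → ℕ),
      (∀ y ≤ P.eval f x, Fs f (Fin.snoc x y) = Fs f' (Fin.snoc x y)) →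
      ∀ y, Fs f (Fin.snoc x y) = Fs f' (Fin.snoc x y)) :
    BFF 1 l (fun f x => Fs f (Fin.snoc x (P.eval f x))) := by

  classical
  have hpos := bff_pos hG
  obtain ⟨d₁, hd₁⟩ := poly_le_chain P
  obtain ⟨d₂, hd₂⟩ := poly_le_chain Q
  obtain ⟨B, hB, hBs⟩ := exists_base hpos
  -- eliminate the levels one by one
  have elim : ∀ d, (∃ Ans Z, BFF 1 (l + d) Ans ∧ BFF 1 (l + d) Z ∧ ∀ f y,
      Ans f y = Fs f (Fin.snoc (lft l d y) (P.eval f (lft l d y))) ∨ RR B d f y (Z f y)) →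
      BFF 1 l (fun f x => Fs f (Fin.snoc x (P.eval f x))) := by
    intro d
    induction d with
    | zero =>
      rintro ⟨Ans, Z, hA, _, h⟩
      refine bff_congr hA (fun f x => ?_)
      rcases h f x with h | h
      · exact h
      · exact h.elim
    | succ d ih =>
      rintro ⟨Ans, Z, hA, hZ, h⟩
      obtain ⟨q, hq, hq'⟩ := bff_level (bff_NN hB d) hZ
      refine ih ⟨_, _, bff_comp hA (sub_snoc sub_id hq), bff_comp hZ (sub_snoc sub_id hq), ?_⟩
      intro f y
      have h1 := h f (Fin.snoc (α := fun _ => ℕ) y (q f y))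
      rw [lft_snoc] at h1
      rcases h1 with h1 | h1
      · exact Or.inl h1
      · simp only [RR, Fin.init_snoc] at h1
        have e := Fin.snoc_last (α := fun _ => ℕ) (q f y) y
        rcases h1 with h1 | h1
        · exact Or.inr h1
        · refine absurd ⟨h1.1, lt_of_eq_of_lt ?_ h1.2⟩ (hq' f y)
          exact congrArg (fun t => Nat.size (smash (f 0 t) 2)) e.symm
  set d := max d₁ d₂ with hd
  apply elim d
  -- the truncated function
  let T : Fin 1 → Fn 1 → Vc (l + d + 1) → ℕ := fun _ f w =>
    if RR B d f (Fin.init (α := fun _ => ℕ) w) (w (Fin.last _)) then 0 else f 0 (w (Fin.last _))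
  let T' : Fin 1 → Fn 1 → Vc (l + d + 1) → ℕ := fun _ f w => f 0 (w (Fin.last _))
  have hT : ∀ i, BFF 1 (l + d + 1) (T i) := fun _ =>
    bff_ite (bp_RR hB d) (bff_zero (by omega)) (bff_ap 0 bff_last)
  have hT' : ∀ i, BFF 1 (l + d + 1) (T' i) := fun _ => bff_ap 0 bff_last
  let tr : Fn 1 → Vc (l + d) → Fn 1 := fun f y i z => T i f (Fin.snoc (α := fun _ => ℕ) y z)
  have tr' : ∀ (f : Fn 1) (y : Vc (l + d)),
      (fun i z => T' i f (Fin.snoc (α := fun _ => ℕ) y z)) = f := by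
    intro f y
    funext i z
    have : i = 0 := Subsingleton.elim _ _
    subst this
    simp [T']
  have htr : ∀ f y z, tr f y 0 z = if RR B d f y z then 0 else f 0 z := by
    intro f y z; simp [tr, T]
  have hch : ∀ f y, chain (tr f y) (lft l d y) d ≤ Nat.size (NN B d f y) := by
    intro f y
    refine chain_le_NN hBs f (tr f y) d y (fun z => ?_)
    rw [htr]
    by_cases h : RR B d f y z
    · left; simp [h]
    · right; simp [h]
  have hPle : ∀ f y, P.eval (tr f y) (lft l d y) ≤ Nat.size (NN B d f y) := fun f y =>
    ((hd₁ _ _).trans (chain_mono _ _ (le_max_left _ _))).trans (hch f y)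
  have hQle : ∀ f y, Q.eval (tr f y) (lft l d y) ≤ Nat.size (NN B d f y) := fun f y =>
    ((hd₂ _ _).trans (chain_mono _ _ (le_max_right _ _))).trans (hch f y)
  have hbd : ∀ f y n, Nat.size (Fs (tr f y) (Fin.snoc (lft l d y) n)) ≤
      Nat.size (NN B d f y) := by
    intro f y n
    rcases le_total n (P.eval (tr f y) (lft l d y)) with h | h
    · exact (hbound _ _ _ h).trans (hQle f y)
    · rw [hstable _ _ _ h]
      exact (hbound _ _ _ le_rfl).trans (hQle f y)
  have hNN := bff_NN hB d
  -- the run with the truncated function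
  have hGT := bff_comp (bff_subst hG T hT) (sub_append (sub_id (k := 1) (l := l + d)) sub_lft)
  simp only [lft_append, rgt_append] at hGT
  have hHT := bff_subst hH T hT
  let V : Fn 1 → Vc (l + d + 1) → ℕ := fun f w =>
    Fs (tr f (Fin.init (α := fun _ => ℕ) w))
      (Fin.snoc (lft l d (Fin.init (α := fun _ => ℕ) w)) (Nat.size (w (Fin.last _))))
  have hV : BFF 1 (l + d + 1) V := by
    have hl : BFF 1 (l + d + 1 + 2) (fun _ z => z (Fin.last (l + d + 1 + 1))) := bff_last
    have hy : BFF 1 (l + d + 1 + 2) (fun _ z => z (Fin.last (l + d + 1)).castSucc) := bff_var _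
    have hiii := sub_init (sub_init (sub_init' (k := 1) (l := l + d + 1 + 1)))
    have hS := bff_comp hHT (sub_append hiii (sub_snoc (sub_snoc
      (sub_comp (sub_lft (p := l) (l := d)) hiii) hl) (bff_len hy)))
    simp only [lft_append, rgt_append] at hS
    refine bff_iter (bff_comp hGT sub_init') hS bff_last (bff_comp hNN sub_init')
      (fun f w n => Fs (tr f (Fin.init (α := fun _ => ℕ) w))
        (Fin.snoc (lft l d (Fin.init (α := fun _ => ℕ) w)) n)) ?_ ?_ ?_
    · intro f w; rw [hbase]
    · intro f w y
      rw [hrec]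
      simp only [Fin.init_snoc, Fin.snoc_last, Fin.snoc_castSucc]
      rfl
    · intro f w n _; exact hbd _ _ _
  -- search for a step at which the truncation matters
  have hHT2 : BFF 1 (l + d + 1) (fun f w => H (tr f (Fin.init (α := fun _ => ℕ) w))
      (Fin.snoc (Fin.snoc (lft l d (Fin.init (α := fun _ => ℕ) w)) (V f w))
        (Nat.size (w (Fin.last _))))) := by
    have := bff_comp hHT (sub_append (sub_init' (l := l + d)) (sub_snoc (sub_snoc
      (sub_comp (sub_lft (p := l) (l := d)) (sub_init' (l := l + d))) hV) (bff_len bff_last)))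
    simpa only [lft_append, rgt_append] using this
  have hH2 : BFF 1 (l + d + 1) (fun f w => H f
      (Fin.snoc (Fin.snoc (lft l d (Fin.init (α := fun _ => ℕ) w)) (V f w))
        (Nat.size (w (Fin.last _))))) :=
    bff_comp hH (sub_snoc (sub_snoc
      (sub_comp (sub_lft (p := l) (l := d)) (sub_init' (l := l + d))) hV) (bff_len bff_last))
  obtain ⟨C, hC, hC'⟩ := bff_search
    (p := fun f y n => H (tr f y) (Fin.snoc (Fin.snoc (lft l d y)
        (Fs (tr f y) (Fin.snoc (lft l d y) n))) n) ≠
      H f (Fin.snoc (Fin.snoc (lft l d y) (Fs (tr f y) (Fin.snoc (lft l d y) n))) n))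
    hNN (bp_not (bp_eq hHT2 hH2))
  obtain ⟨WG, hWG, hWG'⟩ := bff_witness hG T T' hT hT'
  obtain ⟨WH, hWH, hWH'⟩ := bff_witness hH T T' hT hT'
  have hG2 : BFF 1 (l + d) (fun f y => G f (lft l d y)) := bff_comp hG sub_lft
  let EG : Vc (l + d) → Vc (l + d + l) := fun y => Fin.append y (lft l d y)
  let EH : Fn 1 → Vc (l + d) → Vc (l + d + (l + 2)) := fun f y =>
    Fin.append y (Fin.snoc (α := fun _ => ℕ) (Fin.snoc (α := fun _ => ℕ) (lft l d y)
      (V f (Fin.snoc (α := fun _ => ℕ) y (C f y)))) (Nat.size (C f y)))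
  have hEG : Sub 1 (l + d) (l + d + l) (fun _ y => EG y) := sub_append sub_id sub_lft
  have hEH : Sub 1 (l + d) (l + d + (l + 2)) EH := sub_append sub_id
    (sub_snoc (sub_snoc sub_lft (bff_comp hV (sub_snoc sub_id hC))) (bff_len hC))
  refine ⟨_, _, bff_comp hV (sub_snoc sub_id hNN),
    bff_ite (bp_eq hGT hG2) (bff_comp hWH hEH) (bff_comp hWG hEG), ?_⟩
  intro f y
  have hdiff : ∀ z, (∃ i, T i f (Fin.snoc (α := fun _ => ℕ) y z) ≠
      T' i f (Fin.snoc (α := fun _ => ℕ) y z)) → RR B d f y z := by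
    rintro z ⟨i, hi⟩
    by_contra hc
    apply hi
    simp [T, T', hc]
  by_cases h1 : G (tr f y) (lft l d y) = G f (lft l d y)
  · have h1' : G (fun i z => T i f (Fin.snoc (α := fun _ => ℕ) y z)) (lft l d y)
        = G f (lft l d y) := h1
    simp only [h1', if_true]
    by_cases h2 : ∃ n < Nat.size (NN B d f y), H (tr f y) (Fin.snoc (Fin.snoc (lft l d y)
        (Fs (tr f y) (Fin.snoc (lft l d y) n))) n) ≠
      H f (Fin.snoc (Fin.snoc (lft l d y) (Fs (tr f y) (Fin.snoc (lft l d y) n))) n)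
    · right
      have h3 := hC' f y h2
      have h4 := hWH' f (EH f y)
      simp only [EH, lft_append, rgt_append, tr'] at h4
      apply hdiff
      apply h4
      simpa [V] using h3
    · left
      push Not at h2
      have hag : ∀ n, n ≤ Nat.size (NN B d f y) →
          Fs (tr f y) (Fin.snoc (lft l d y) n) = Fs f (Fin.snoc (lft l d y) n) := by
        intro n
        induction n with
        | zero => intro _; rw [hbase, hbase, h1]
        | succ n ih =>
          intro hn
          rw [hrec, hrec, h2 n (by omega), ih (by omega)]
      have hall := hagree (lft l d y) (tr f y) f (fun n hn => hag n (hn.trans (hPle f y)))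
      simp only [V, Fin.init_snoc, Fin.snoc_last]
      rw [hstable _ _ _ (hPle f y), ← hstable _ _ _ (le_max_left _ (P.eval f (lft l d y))), hall,
        hstable _ _ _ (le_max_right _ _)]
  · right
    have h1' : ¬ G (fun i z => T i f (Fin.snoc (α := fun _ => ℕ) y z)) (lft l d y)
        = G f (lft l d y) := h1
    simp only [h1', if_false]
    apply hdiff
    have h4 := hWG' f (EG y)
    simp only [EG, lft_append, rgt_append, tr'] at h4
    exact h4 h1
end

section
/- For every basic feasible functional F(f⃗,x⃗) there exists a second-order polynomial P(|f⃗|,|x⃗|) such that for all function arguments f⃗ and all number arguments x⃗, |F(f⃗,x⃗)| ≤ P(|f⃗|,|x⃗|). -/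
/-- Renaming of the variables of a second-order polynomial. -/
def SOPoly.rename {k l k' l' : ℕ} (ρ : Fin k → Fin k') (σ : Fin l → Fin l') :
    SOPoly k l → SOPoly k' l'
  | const n => const n
  | len j => len (σ j)
  | add p q => add (p.rename ρ σ) (q.rename ρ σ)
  | mul p q => mul (p.rename ρ σ) (q.rename ρ σ)
  | app i p => app (ρ i) (p.rename ρ σ)

/-- Substitution of polynomials for the number lengths. -/
def SOPoly.subst {k l l' : ℕ} (s : Fin l → SOPoly k l') : SOPoly k l → SOPoly k l'
  | const n => const n
  | len j => s j
  | add p q => add (p.subst s) (q.subst s)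
  | mul p q => mul (p.subst s) (q.subst s)
  | app i p => app i (p.subst s)

lemma SOPoly.eval_rename {k l k' l' : ℕ} (ρ : Fin k → Fin k') (σ : Fin l → Fin l')
    (f : Fin k' → ℕ → ℕ) (x : Fin l' → ℕ) (p : SOPoly k l) :
    (p.rename ρ σ).eval f x = p.eval (fun i => f (ρ i)) (fun j => x (σ j)) := by
  induction p <;> simp_all [SOPoly.rename, SOPoly.eval]

lemma fnorm_mono (f : ℕ → ℕ) {a b : ℕ} (h : a ≤ b) : fnorm f a ≤ fnorm f b := by
  unfold fnorm
  apply Finset.sup_mono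
  intro y hy
  simp only [Finset.mem_range] at hy ⊢
  exact lt_of_lt_of_le hy (Nat.pow_le_pow_right (by norm_num) h)

lemma size_le_fnorm (f : ℕ → ℕ) (y : ℕ) : Nat.size (f y) ≤ fnorm f (Nat.size y) := by
  unfold fnorm
  exact Finset.le_sup (f := fun y => Nat.size (f y)) (Finset.mem_range.mpr (Nat.lt_size_self y))

lemma SOPoly.eval_le_subst {k l l' : ℕ} (s : Fin l → SOPoly k l')
    (f : Fin k → ℕ → ℕ) (x : Fin l' → ℕ) (z : Fin l → ℕ)
    (h : ∀ j, Nat.size (z j) ≤ (s j).eval f x) (p : SOPoly k l) :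
    p.eval f z ≤ (p.subst s).eval f x := by
  induction p with
  | const n => exact le_rfl
  | len j => exact h j
  | add p q hp hq => exact Nat.add_le_add hp hq
  | mul p q hp hq => exact Nat.mul_le_mul hp hq
  | app i p hp => exact fnorm_mono _ hp

lemma size_two_mul_add_one_le (n : ℕ) : Nat.size (2 * n + 1) ≤ Nat.size n + 1 := by
  rw [Nat.size_le, pow_succ]
  have := Nat.lt_size_self n
  omega

/-- Every basic feasible functional is majorized (in length) by a second-order polynomial:
for every `F ∈ BFF` there is a second-order polynomial `P` with `|F(f⃗,x⃗)| ≤ P(|f⃗|,|x⃗|)`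
for all `f⃗` and `x⃗`. -/
theorem bff_majorized_by_second_order_polynomial (k l : ℕ)
    (F : (Fin k → ℕ → ℕ) → (Fin l → ℕ) → ℕ) (hF : BFF k l F) :
    ∃ P : SOPoly k l, ∀ (f : Fin k → ℕ → ℕ) (x : Fin l → ℕ),
      Nat.size (F f x) ≤ P.eval f x := by
  induction hF with
  | zero => exact ⟨.const 0, fun f x => by simp⟩
  | s0 =>
    refine ⟨.add (.len 0) (.const 1), fun f x => ?_⟩
    exact (Nat.size_le_size (Nat.le_succ (2 * x 0))).trans (size_two_mul_add_one_le (x 0))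
  | s1 => exact ⟨.add (.len 0) (.const 1), fun f x => size_two_mul_add_one_le (x 0)⟩
  | proj n i => exact ⟨.len i, fun f x => le_rfl⟩
  | smashF =>
    refine ⟨.add (.mul (.len 0) (.len 1)) (.const 1), fun f x => ?_⟩
    simp only [smash, Nat.size_pow, SOPoly.eval, le_refl]
  | ap => exact ⟨.app 0 (.len 0), fun f x => size_le_fnorm (f 0) (x 0)⟩
  | expansion ρ σ hρ hσ hG ih =>
    obtain ⟨P, hP⟩ := ih
    refine ⟨P.rename ρ σ, fun f x => ?_⟩
    rw [SOPoly.eval_rename]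
    exact hP _ _
  | comp hH hG ihH ihG =>
    obtain ⟨P, hP⟩ := ihH
    choose Q hQ using ihG
    refine ⟨P.subst (Fin.append Q .len), fun f x => (hP _ _).trans ?_⟩
    apply SOPoly.eval_le_subst
    intro j
    refine Fin.addCases (fun i => ?_) (fun i => ?_) j
    · simpa using hQ i f x
    · simp [SOPoly.eval]
  | lrn F hG hH₁ hH₂ hK hbase heven hodd hbound ihG ihH₁ ihH₂ ihK =>
    obtain ⟨P, hP⟩ := ihK
    exact ⟨P, fun f x => (hbound f x).trans (hP f x)⟩
end

section
/- The functional of rank (1,1) defined by (f,x) ↦ |f|(|x|), where |f| is the norm of f, is not a basic feasible functional; moreover it cannot be majorized by any basic feasible functional, i.e., for every basic feasible functional G(f,x) of rank (1,1) there exist f : ℕ→ℕ and x ∈ ℕ such that |f|(|x|) > G(f,x). -/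
/-- Polynomially many queries suffice at the zero oracle. -/
def Good (k l : ℕ) (F : (Fin k → ℕ → ℕ) → (Fin l → ℕ) → ℕ) : Prop :=
  ∃ p : Polynomial ℕ, ∀ (n : ℕ) (x : Fin l → ℕ), (∀ i, Nat.size (x i) ≤ n) →
    Nat.size (F (fun _ _ => 0) x) ≤ p.eval n ∧
    ∃ Q : Finset ℕ, Q.card ≤ p.eval n ∧
      ∀ f : Fin k → ℕ → ℕ, (∀ i, ∀ q ∈ Q, f i q = 0) → F f x = F (fun _ _ => 0) x

theorem poly_eval_mono (p : Polynomial ℕ) {a b : ℕ} (h : a ≤ b) : p.eval a ≤ p.eval b := by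
  induction p using Polynomial.induction_on' with
  | add p q hp hq => simp only [Polynomial.eval_add]; omega
  | monomial n c => simp only [Polynomial.eval_monomial]; gcongr

theorem poly_bound (p : Polynomial ℕ) : ∃ c, ∀ n : ℕ, p.eval n ≤ (n + 2) ^ c := by
  induction p using Polynomial.induction_on' with
  | add p q hp hq =>
    obtain ⟨c, hc⟩ := hp
    obtain ⟨d, hd⟩ := hq
    refine ⟨c + d + 1, fun n => ?_⟩
    have h1 : (n + 2) ^ c ≤ (n + 2) ^ (c + d) := Nat.pow_le_pow_right (by omega) (by omega)
    have h2 : (n + 2) ^ d ≤ (n + 2) ^ (c + d) := Nat.pow_le_pow_right (by omega) (by omega)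
    have := hc n
    have := hd n
    rw [Polynomial.eval_add, pow_succ]
    nlinarith
  | monomial m c =>
    refine ⟨c + m, fun n => ?_⟩
    rw [Polynomial.eval_monomial, pow_add]
    have h1 : c ≤ (n + 2) ^ c :=
      (Nat.lt_two_pow_self).le.trans (Nat.pow_le_pow_left (by omega) c)
    have h2 : n ^ m ≤ (n + 2) ^ m := Nat.pow_le_pow_left (by omega) m
    exact Nat.mul_le_mul h1 h2

theorem poly_lt_two_pow (p : Polynomial ℕ) : ∃ n : ℕ, p.eval n < 2 ^ n := by
  obtain ⟨c, hc⟩ := poly_bound p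
  have key : ∃ m : ℕ, 1 ≤ m ∧ m * c + 2 < 2 ^ m := by
    refine ⟨2 * (c + 3), by omega, ?_⟩
    have h : c + 1 ≤ 2 ^ c := Nat.lt_two_pow_self
    have h' : 8 * (c + 1) ≤ 2 ^ (c + 3) := by rw [pow_add]; omega
    rw [pow_mul', sq]
    nlinarith
  obtain ⟨m, hm1, hm⟩ := key
  refine ⟨2 ^ m - 2, (hc _).trans_lt ?_⟩
  have h2 : 2 ^ m - 2 + 2 = 2 ^ m := by omega
  rw [h2, ← pow_mul]
  exact Nat.pow_lt_pow_right (by omega) (by omega)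

theorem good_expansion {k l k' l' : ℕ} (ρ : Fin k → Fin k') (σ : Fin l → Fin l')
    {G : (Fin k → ℕ → ℕ) → (Fin l → ℕ) → ℕ} (hG : Good k l G) :
    Good k' l' (fun f x => G (fun i => f (ρ i)) (fun j => x (σ j))) := by
  obtain ⟨p, hp⟩ := hG
  refine ⟨p, fun n x hx => ?_⟩
  obtain ⟨h1, Q, hQ, h2⟩ := hp n (fun j => x (σ j)) (fun i => hx _)
  exact ⟨h1, Q, hQ, fun f hf => h2 _ (fun i q hq => hf _ q hq)⟩

theorem good_comp {k l m : ℕ} {H : (Fin k → ℕ → ℕ) → (Fin (m + l) → ℕ) → ℕ}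
    {G : Fin m → (Fin k → ℕ → ℕ) → (Fin l → ℕ) → ℕ}
    (hH : Good k (m + l) H) (hG : ∀ i, Good k l (G i)) :
    Good k l (fun f x => H f (Fin.append (fun i => G i f x) x)) := by
  obtain ⟨p, hp⟩ := hH
  choose q hq using hG
  refine ⟨p.comp (Polynomial.X + ∑ i, q i) + ∑ i, q i, fun n x hx => ?_⟩
  have hs : ∀ i, (q i).eval n ≤ ∑ i, (q i).eval n := fun i =>
    Finset.single_le_sum (f := fun i => (q i).eval n) (fun _ _ => Nat.zero_le _)
      (Finset.mem_univ i)
  simp only [Polynomial.eval_add, Polynomial.eval_comp, Polynomial.eval_X,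
    Polynomial.eval_finsetSum]
  have hg := fun i => hq i n x hx
  choose hg1 Q hQ hg2 using hg
  obtain ⟨h1, R, hR, h2⟩ := hp (n + ∑ i, (q i).eval n)
    (Fin.append (fun i => G i (fun _ _ => 0) x) x) (by
      intro i
      refine Fin.addCases (fun j => ?_) (fun j => ?_) i
      · rw [Fin.append_left]
        have := hg1 j
        have := hs j
        omega
      · rw [Fin.append_right]
        have := hx j
        omega)
  refine ⟨by omega, R ∪ Finset.univ.biUnion Q, ?_, fun f hf => ?_⟩
  · have a1 := Finset.card_union_le R (Finset.univ.biUnion Q)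
    have a2 : (Finset.univ.biUnion Q).card ≤ ∑ i, (q i).eval n :=
      Finset.card_biUnion_le.trans (Finset.sum_le_sum fun i _ => hQ i)
    omega
  · have : (fun i => G i f x) = (fun i => G i (fun _ _ => 0) x) := by
      funext i
      refine hg2 i f (fun j a ha => hf j a ?_)
      exact Finset.mem_union_right _ (Finset.mem_biUnion.2 ⟨i, Finset.mem_univ i, ha⟩)
    rw [this]
    exact h2 f (fun j a ha => hf j a (Finset.mem_union_left _ ha))

theorem size_two_mul' {y : ℕ} (hy : 0 < y) : Nat.size (2 * y) = Nat.size y + 1 := by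
  have := Nat.size_bit (b := false) (n := y) (by simp; omega)
  simpa using this

theorem size_two_mul_add_one' (y : ℕ) : Nat.size (2 * y + 1) = Nat.size y + 1 := by
  have := Nat.size_bit (b := true) (n := y) (by simp)
  simpa using this

theorem good_lrn {k l : ℕ} (F : (Fin k → ℕ → ℕ) → (Fin (l + 1) → ℕ) → ℕ)
      {G : (Fin k → ℕ → ℕ) → (Fin l → ℕ) → ℕ}
      {H₁ H₂ : (Fin k → ℕ → ℕ) → (Fin (l + 2) → ℕ) → ℕ}
      {K : (Fin k → ℕ → ℕ) → (Fin (l + 1) → ℕ) → ℕ}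
      (hG : Good k l G) (hH₁ : Good k (l + 2) H₁) (hH₂ : Good k (l + 2) H₂)
      (hK : Good k (l + 1) K)
      (hbase : ∀ f x, F f (Fin.snoc x 0) = G f x)
      (heven : ∀ f x y, 0 < y →
        F f (Fin.snoc x (2 * y)) = H₁ f (Fin.snoc (Fin.snoc x y) (F f (Fin.snoc x y))))
      (hodd : ∀ f x y,
        F f (Fin.snoc x (2 * y + 1)) = H₂ f (Fin.snoc (Fin.snoc x y) (F f (Fin.snoc x y))))
      (hbound : ∀ f x, Nat.size (F f x) ≤ Nat.size (K f x)) :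
      Good k (l + 1) F := by
  obtain ⟨g, hg⟩ := hG
  obtain ⟨h1, hh1⟩ := hH₁
  obtain ⟨h2, hh2⟩ := hH₂
  obtain ⟨r, hr⟩ := hK
  refine ⟨r + (g + Polynomial.X * (h1 + h2).comp (Polynomial.X + r)), fun n x hx => ?_⟩
  simp only [Polynomial.eval_add, Polynomial.eval_comp, Polynomial.eval_X, Polynomial.eval_mul]
  set M := h1.eval (n + r.eval n) + h2.eval (n + r.eval n) with hM
  refine ⟨((hbound _ _).trans (hr n x hx).1).trans (Nat.le_add_right _ _), ?_⟩
  have hx1 : ∀ i, Nat.size ((Fin.init x : Fin l → ℕ) i) ≤ n := fun i => hx _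
  have hsn : ∀ y, Nat.size y ≤ n →
      ∀ i, Nat.size ((Fin.snoc (Fin.init x) y : Fin (l + 1) → ℕ) i) ≤ n := by
    intro y hy i
    refine Fin.lastCases ?_ (fun j => ?_) i
    · simpa using hy
    · simpa using hx1 j
  have harg : ∀ y, Nat.size y ≤ n → ∀ i, Nat.size ((Fin.snoc
      (Fin.snoc (Fin.init x) y : Fin (l + 1) → ℕ)
      (F (fun _ _ => 0) (Fin.snoc (Fin.init x) y)) : Fin (l + 2) → ℕ) i) ≤ n + r.eval n := by
    intro y hy i
    refine Fin.lastCases ?_ (fun j => ?_) i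
    · rw [Fin.snoc_last]
      exact ((hbound _ _).trans (hr n _ (hsn y hy)).1).trans (Nat.le_add_left _ _)
    · rw [Fin.snoc_castSucc]
      exact (hsn y hy j).trans (Nat.le_add_right _ _)
  have main : ∀ y, Nat.size y ≤ n → ∃ Q : Finset ℕ, Q.card ≤ g.eval n + Nat.size y * M ∧
      ∀ f : Fin k → ℕ → ℕ, (∀ i, ∀ q ∈ Q, f i q = 0) →
        F f (Fin.snoc (Fin.init x) y) = F (fun _ _ => 0) (Fin.snoc (Fin.init x) y) := by
    intro y
    induction y using Nat.strong_induction_on with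
    | _ y ih =>
      intro hy
      rcases Nat.eq_zero_or_pos y with rfl | hpos
      · obtain ⟨-, Q, hQ, hf⟩ := hg n _ hx1
        refine ⟨Q, hQ.trans (Nat.le_add_right _ _), fun f h => ?_⟩
        rw [hbase, hbase]
        exact hf f h
      · rcases Nat.even_or_odd' y with ⟨z, rfl | rfl⟩
        · have hz : 0 < z := by omega
          rw [size_two_mul' hz] at hy ⊢
          obtain ⟨Q, hQ, hf⟩ := ih z (by omega) (by omega)
          obtain ⟨-, R, hR, hf'⟩ := hh1 _ _ (harg z (by omega))
          refine ⟨Q ∪ R, ?_, fun f h => ?_⟩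
          · have := Finset.card_union_le Q R
            rw [add_mul]
            omega
          · rw [heven _ _ _ hz, heven _ _ _ hz,
              hf f (fun i q hq => h i q (Finset.mem_union_left _ hq))]
            exact hf' f (fun i q hq => h i q (Finset.mem_union_right _ hq))
        · rw [size_two_mul_add_one'] at hy ⊢
          obtain ⟨Q, hQ, hf⟩ := ih z (by omega) (by omega)
          obtain ⟨-, R, hR, hf'⟩ := hh2 _ _ (harg z (by omega))
          refine ⟨Q ∪ R, ?_, fun f h => ?_⟩
          · have := Finset.card_union_le Q R
            rw [add_mul]
            omega
          · rw [hodd, hodd, hf f (fun i q hq => h i q (Finset.mem_union_left _ hq))]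
            exact hf' f (fun i q hq => h i q (Finset.mem_union_right _ hq))
  obtain ⟨Q, hQ, hf⟩ := main (x (Fin.last l)) (hx _)
  rw [Fin.snoc_init_self] at hf
  refine ⟨Q, hQ.trans ?_, hf⟩
  have := Nat.mul_le_mul_right M (hx (Fin.last l))
  omega

theorem good_of_bff {k l : ℕ} {F : (Fin k → ℕ → ℕ) → (Fin l → ℕ) → ℕ} (h : BFF k l F) :
    Good k l F := by
  induction h with
  | zero => exact ⟨0, fun n x hx => ⟨by simp, ∅, by simp, fun _ _ => rfl⟩⟩
  | s0 =>
    refine ⟨Polynomial.X + 1, fun n x hx => ⟨?_, ∅, by simp, fun _ _ => rfl⟩⟩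
    have := hx 0
    rcases Nat.eq_zero_or_pos (x 0) with h | h
    · simp [h]
    · rw [size_two_mul' h]
      simpa using this
  | s1 =>
    refine ⟨Polynomial.X + 1, fun n x hx => ⟨?_, ∅, by simp, fun _ _ => rfl⟩⟩
    have := hx 0
    rw [size_two_mul_add_one']
    simpa using this
  | proj n i =>
    exact ⟨Polynomial.X, fun n x hx => ⟨by simpa using hx i, ∅, by simp, fun _ _ => rfl⟩⟩
  | smashF =>
    refine ⟨Polynomial.X * Polynomial.X + 1, fun n x hx => ⟨?_, ∅, by simp, fun _ _ => rfl⟩⟩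
    have := Nat.mul_le_mul (hx 0) (hx 1)
    simp only [smash, Nat.size_pow]
    simpa using this
  | ap =>
    exact ⟨1, fun n x hx => ⟨by simp, {x 0}, by simp,
      fun f hf => hf 0 (x 0) (Finset.mem_singleton_self _)⟩⟩
  | expansion ρ σ _ _ _ ih => exact good_expansion ρ σ ih
  | comp _ _ ihH ihG => exact good_comp ihH ihG
  | lrn F _ _ _ _ hbase heven hodd hbound ihG ih1 ih2 ihK =>
    exact good_lrn F ihG ih1 ih2 ihK hbase heven hodd hbound

theorem not_majorized_aux (G : (Fin 1 → ℕ → ℕ) → (Fin 1 → ℕ) → ℕ) (hG : BFF 1 1 G) :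
    ∃ (f : Fin 1 → ℕ → ℕ) (x : Fin 1 → ℕ), G f x < fnorm (f 0) (Nat.size (x 0)) := by
  obtain ⟨p, hp⟩ := good_of_bff hG
  obtain ⟨n, hn⟩ := poly_lt_two_pow p
  have hsz : Nat.size (2 ^ n - 1) = n := by
    apply le_antisymm
    · rw [Nat.size_le]
      have : 0 < 2 ^ n := by positivity
      omega
    · rcases Nat.eq_zero_or_pos n with rfl | h
      · simp
      · have : n - 1 < Nat.size (2 ^ n - 1) := by
          rw [Nat.lt_size]
          have : 2 ^ n = 2 * 2 ^ (n - 1) := by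
            rw [← pow_succ']
            congr 1
            omega
          have : 0 < 2 ^ (n - 1) := by positivity
          omega
        omega
  obtain ⟨-, Q, hQ, hf⟩ := hp n (fun _ => 2 ^ n - 1) (fun _ => hsz.le)
  obtain ⟨y, hy, hyQ⟩ : ∃ y ∈ Finset.range (2 ^ n), y ∉ Q := by
    apply Finset.exists_mem_notMem_of_card_lt_card
    rw [Finset.card_range]
    omega
  set v := G (fun _ _ => 0) (fun _ => 2 ^ n - 1) with hv
  refine ⟨fun _ z => if z = y then 2 ^ v else 0, fun _ => 2 ^ n - 1, ?_⟩
  have hz : ∀ i : Fin 1, ∀ q ∈ Q,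
      (fun (_ : Fin 1) z => if z = y then 2 ^ v else 0) i q = 0 := by
    intro i q hq
    have hqy : q ≠ y := fun h => hyQ (h ▸ hq)
    simp [hqy]
  rw [hf _ hz, hsz]
  have := Finset.le_sup (f := fun z => Nat.size (if z = y then 2 ^ v else 0)) hy
  simp only [if_true, Nat.size_pow] at this
  exact this

theorem norm_functional_not_bff_and_not_majorized :
    ¬ BFF 1 1 (fun f x => fnorm (f 0) (Nat.size (x 0))) ∧
    ∀ G : (Fin 1 → ℕ → ℕ) → (Fin 1 → ℕ) → ℕ, BFF 1 1 G →
      ∃ (f : Fin 1 → ℕ → ℕ) (x : Fin 1 → ℕ),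
        G f x < fnorm (f 0) (Nat.size (x 0)) := by
  refine ⟨fun h => ?_, not_majorized_aux⟩
  obtain ⟨f, x, hlt⟩ := not_majorized_aux _ h
  exact lt_irrefl _ hlt
end

section
/- Cobham's class of functions is unchanged if the bounding condition |f(x⃗,y)| ≤ |k(x⃗,y)| in the scheme of limited recursion on notation is replaced by the condition |f(x⃗,y)| ≤ q(|x⃗|,|y|) where q is a polynomial with natural number coefficients: the least class of functions ℕ^l → ℕ containing the initial functions and closed under composition and limited recursion on notation with this polynomial length bound equals Cobham's class. -/
/-- Cobham's class of polynomial-time computable functions: the least class of functions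
`ℕ^l → ℕ` containing the basic functions `o(x)=0`, `s₀(x)=2x`, `s₁(x)=2x+1`, the projections
and `x#y`, closed under composition and limited recursion on notation. -/
inductive Cobham : (l : ℕ) → ((Fin l → ℕ) → ℕ) → Prop
  | zero : Cobham 1 (fun _ => 0)
  | s0 : Cobham 1 (fun x => 2 * x 0)
  | s1 : Cobham 1 (fun x => 2 * x 0 + 1)
  | proj (n : ℕ) (i : Fin n) : Cobham n (fun x => x i)
  | smashF : Cobham 2 (fun x => smash (x 0) (x 1))
  | comp {l m : ℕ} {h : (Fin m → ℕ) → ℕ} {g : Fin m → (Fin l → ℕ) → ℕ}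
      (hh : Cobham m h) (hg : ∀ i, Cobham l (g i)) :
      Cobham l (fun x => h (fun i => g i x))
  | lrn {l : ℕ} (f : (Fin (l + 1) → ℕ) → ℕ)
      {g : (Fin l → ℕ) → ℕ} {h₁ h₂ : (Fin (l + 2) → ℕ) → ℕ} {K : (Fin (l + 1) → ℕ) → ℕ}
      (hg : Cobham l g) (hh₁ : Cobham (l + 2) h₁) (hh₂ : Cobham (l + 2) h₂)
      (hK : Cobham (l + 1) K)
      (hbase : ∀ x, f (Fin.snoc x 0) = g x)
      (heven : ∀ x y, 0 < y →
        f (Fin.snoc x (2 * y)) = h₁ (Fin.snoc (Fin.snoc x y) (f (Fin.snoc x y))))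
      (hodd : ∀ x y,
        f (Fin.snoc x (2 * y + 1)) = h₂ (Fin.snoc (Fin.snoc x y) (f (Fin.snoc x y))))
      (hbound : ∀ x, Nat.size (f x) ≤ Nat.size (K x)) :
      Cobham (l + 1) f

/-- The variant of Cobham's class in which the bound in limited recursion on notation is
`|f(x⃗,y)| ≤ q(|x⃗|,|y|)` for a polynomial `q` with natural number coefficients. -/
inductive CobhamP : (l : ℕ) → ((Fin l → ℕ) → ℕ) → Prop
  | zero : CobhamP 1 (fun _ => 0)
  | s0 : CobhamP 1 (fun x => 2 * x 0)
  | s1 : CobhamP 1 (fun x => 2 * x 0 + 1)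
  | proj (n : ℕ) (i : Fin n) : CobhamP n (fun x => x i)
  | smashF : CobhamP 2 (fun x => smash (x 0) (x 1))
  | comp {l m : ℕ} {h : (Fin m → ℕ) → ℕ} {g : Fin m → (Fin l → ℕ) → ℕ}
      (hh : CobhamP m h) (hg : ∀ i, CobhamP l (g i)) :
      CobhamP l (fun x => h (fun i => g i x))
  | lrn {l : ℕ} (f : (Fin (l + 1) → ℕ) → ℕ)
      {g : (Fin l → ℕ) → ℕ} {h₁ h₂ : (Fin (l + 2) → ℕ) → ℕ}
      (q : MvPolynomial (Fin (l + 1)) ℕ)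
      (hg : CobhamP l g) (hh₁ : CobhamP (l + 2) h₁) (hh₂ : CobhamP (l + 2) h₂)
      (hbase : ∀ x, f (Fin.snoc x 0) = g x)
      (heven : ∀ x y, 0 < y →
        f (Fin.snoc x (2 * y)) = h₁ (Fin.snoc (Fin.snoc x y) (f (Fin.snoc x y))))
      (hodd : ∀ x y,
        f (Fin.snoc x (2 * y + 1)) = h₂ (Fin.snoc (Fin.snoc x y) (f (Fin.snoc x y))))
      (hbound : ∀ x y, Nat.size (f (Fin.snoc x y)) ≤
        MvPolynomial.eval (fun i => Nat.size ((Fin.snoc x y : Fin (l + 1) → ℕ) i)) q) :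
      CobhamP (l + 1) f

theorem size_two_mul_add_one_aux (n : ℕ) : Nat.size (2 * n + 1) = Nat.size n + 1 := by
  have := Nat.size_bit (b := true) (n := n) (by simp [Nat.bit])
  simpa [Nat.bit] using this

theorem size_two_mul_le_aux (n : ℕ) : Nat.size (2 * n) ≤ Nat.size n + 1 := by
  rw [← size_two_mul_add_one_aux]
  exact Nat.size_le_size (by omega)

theorem size_smash_aux (x y : ℕ) : Nat.size (smash x y) = Nat.size x * Nat.size y + 1 := by
  unfold smash
  exact Nat.size_pow

theorem eval_mono_aux {n : ℕ} (q : MvPolynomial (Fin n) ℕ) {u v : Fin n → ℕ}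
    (h : ∀ i, u i ≤ v i) : MvPolynomial.eval u q ≤ MvPolynomial.eval v q := by
  induction q using MvPolynomial.induction_on with
  | C a => simp
  | add p q hp hq => simpa using Nat.add_le_add hp hq
  | mul_X p i hp => simpa using Nat.mul_le_mul hp (h i)

/-- Every function of Cobham's class has polynomially bounded length. -/
theorem Cobham.poly_bound {l : ℕ} {f : (Fin l → ℕ) → ℕ} (hf : Cobham l f) :
    ∃ q : MvPolynomial (Fin l) ℕ, ∀ x, Nat.size (f x) ≤
      MvPolynomial.eval (fun i => Nat.size (x i)) q := by
  induction hf with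
  | zero => exact ⟨0, fun x => by simp⟩
  | s0 =>
    exact ⟨MvPolynomial.X 0 + 1, fun x => by simpa using size_two_mul_le_aux (x 0)⟩
  | s1 =>
    exact ⟨MvPolynomial.X 0 + 1, fun x => by simpa using (size_two_mul_add_one_aux (x 0)).le⟩
  | proj n i => exact ⟨MvPolynomial.X i, fun x => by simp⟩
  | smashF =>
    exact ⟨MvPolynomial.X 0 * MvPolynomial.X 1 + 1,
      fun x => by simpa using (size_smash_aux (x 0) (x 1)).le⟩
  | comp hh hg ihh ihg =>
    obtain ⟨p, hp⟩ := ihh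
    choose r hr using ihg
    refine ⟨MvPolynomial.bind₁ r p, fun x => (hp _).trans ?_⟩
    have key : MvPolynomial.eval (fun i => Nat.size (x i)) (MvPolynomial.bind₁ r p)
        = MvPolynomial.eval (fun j => MvPolynomial.eval (fun i => Nat.size (x i)) (r j)) p := by
      clear hp
      induction p using MvPolynomial.induction_on with
      | C a => simp
      | add p q hp hq => simp_all
      | mul_X p i hp => simp_all
    rw [key]
    exact eval_mono_aux p fun j => hr j x
  | lrn f hg hh₁ hh₂ hK hbase heven hodd hbound ihg ih₁ ih₂ ihK =>
    obtain ⟨q, hq⟩ := ihK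
    exact ⟨q, fun x => (hbound x).trans (hq x)⟩

theorem Cobham.comp1 {l : ℕ} {h : (Fin 1 → ℕ) → ℕ} {a : (Fin l → ℕ) → ℕ}
    (hh : Cobham 1 h) (ha : Cobham l a) : Cobham l (fun x => h (fun _ => a x)) :=
  Cobham.comp (g := fun _ => a) hh fun _ => ha

theorem Cobham.smash_comp {l : ℕ} {a b : (Fin l → ℕ) → ℕ}
    (ha : Cobham l a) (hb : Cobham l b) : Cobham l (fun x => smash (a x) (b x)) :=
  Cobham.comp (g := ![a, b]) Cobham.smashF fun i => by
    fin_cases i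
    · exact ha
    · exact hb

theorem Cobham.const {l : ℕ} (n : ℕ) : Cobham (l + 1) (fun _ => 2 ^ n - 1) := by
  induction n with
  | zero => exact Cobham.comp1 Cobham.zero (Cobham.proj (l + 1) 0)
  | succ n ih =>
    have := Cobham.comp1 Cobham.s1 ih
    have e : 2 ^ (n + 1) - 1 = 2 * (2 ^ n - 1) + 1 := by
      have := Nat.one_le_two_pow (n := n)
      rw [pow_succ]
      omega
    rw [e]
    exact this

theorem size_const_aux (n : ℕ) : n ≤ Nat.size (2 ^ n - 1) := by
  induction n with
  | zero => simp
  | succ n ih =>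
    have e : 2 ^ (n + 1) - 1 = 2 * (2 ^ n - 1) + 1 := by
      have := Nat.one_le_two_pow (n := n)
      rw [pow_succ]
      omega
    rw [e, size_two_mul_add_one_aux]
    omega

/-- Every polynomial in the lengths is dominated by the length of a function in the class. -/
theorem Cobham.dominate {l : ℕ} (q : MvPolynomial (Fin (l + 1)) ℕ) :
    ∃ K, Cobham (l + 1) K ∧ ∀ x, MvPolynomial.eval (fun i => Nat.size (x i)) q ≤
      Nat.size (K x) := by
  induction q using MvPolynomial.induction_on with
  | C a => exact ⟨_, Cobham.const a, fun x => by simpa using size_const_aux a⟩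
  | add p q hp hq =>
    obtain ⟨A, hA, hA'⟩ := hp
    obtain ⟨B, hB, hB'⟩ := hq
    refine ⟨_, Cobham.smash_comp (Cobham.comp1 Cobham.s1 hA) (Cobham.comp1 Cobham.s1 hB),
      fun x => ?_⟩
    rw [size_smash_aux, size_two_mul_add_one_aux, size_two_mul_add_one_aux, map_add]
    nlinarith [hA' x, hB' x]
  | mul_X p i hp =>
    obtain ⟨A, hA, hA'⟩ := hp
    refine ⟨_, Cobham.smash_comp hA (Cobham.proj _ i), fun x => ?_⟩
    rw [size_smash_aux, map_mul, MvPolynomial.eval_X]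
    exact (Nat.mul_le_mul_right _ (hA' x)).trans (Nat.le_succ _)

/-- Cobham's class is unchanged if the bounding condition `|f(x⃗,y)| ≤ |k(x⃗,y)|` in limited
recursion on notation is replaced by `|f(x⃗,y)| ≤ q(|x⃗|,|y|)` for a polynomial `q` with
natural number coefficients. -/
theorem cobhamP_iff_cobham (l : ℕ) (f : (Fin l → ℕ) → ℕ) :
    CobhamP l f ↔ Cobham l f := by
  constructor
  · intro hf
    induction hf with
    | zero => exact Cobham.zero
    | s0 => exact Cobham.s0
    | s1 => exact Cobham.s1
    | proj n i => exact Cobham.proj n i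
    | smashF => exact Cobham.smashF
    | comp hh hg ihh ihg => exact Cobham.comp ihh ihg
    | lrn f q hg hh₁ hh₂ hbase heven hodd hbound ihg ih₁ ih₂ =>
      obtain ⟨K, hK, hK'⟩ := Cobham.dominate q
      refine Cobham.lrn f ihg ih₁ ih₂ hK hbase heven hodd fun x => ?_
      have h := hbound (Fin.init x) (x (Fin.last _))
      rw [Fin.snoc_init_self] at h
      exact h.trans (hK' x)
  · intro hf
    induction hf with
    | zero => exact CobhamP.zero
    | s0 => exact CobhamP.s0
    | s1 => exact CobhamP.s1
    | proj n i => exact CobhamP.proj n i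
    | smashF => exact CobhamP.smashF
    | comp hh hg ihh ihg => exact CobhamP.comp ihh ihg
    | lrn f hg hh₁ hh₂ hK hbase heven hodd hbound ihg ih₁ ih₂ ihK =>
      obtain ⟨q, hq⟩ := hK.poly_bound
      exact CobhamP.lrn f q ihg ih₁ ih₂ hbase heven hodd fun x y => (hbound _).trans (hq _)
end

section
/- A function F : ℕ^l → ℕ, regarded as a type 2 functional of rank (0,l) (i.e., with no function arguments), is a basic feasible functional if and only if F belongs to Cobham's class of polynomial-time computable functions. -/
theorem BFF.toCobham {k l : ℕ} {F : (Fin k → ℕ → ℕ) → (Fin l → ℕ) → ℕ} (h : BFF k l F) :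
    k = 0 → ∀ f, Cobham l (F f) := by
  induction h with
  | zero => intro _ _; exact Cobham.zero
  | s0 => intro _ _; exact Cobham.s0
  | s1 => intro _ _; exact Cobham.s1
  | proj n i => intro _ _; exact Cobham.proj n i
  | smashF => intro _ _; exact Cobham.smashF
  | ap => intro h; exact absurd h one_ne_zero
  | @expansion k l k' l' ρ σ hρ hσ G hG ih =>
    intro hk f
    have hk0 : k = 0 := by
      have := Fintype.card_le_of_injective ρ hρ
      simp only [Fintype.card_fin] at this
      omega
    exact Cobham.comp (ih hk0 (fun i => f (ρ i))) (fun j => Cobham.proj l' (σ j))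
  | @comp k l m H G hH hG ihH ihG =>
    intro hk f
    have key : Cobham l (fun x => H f (fun i =>
        (Fin.append (fun i => G i f) (fun j (x : Fin l → ℕ) => x j) : Fin (m + l) → _) i x)) := by
      refine Cobham.comp (ihH hk f) (fun i => ?_)
      refine Fin.addCases (fun i => ?_) (fun j => ?_) i
      · rw [Fin.append_left]; exact ihG i hk f
      · rw [Fin.append_right]; exact Cobham.proj l j
    convert key using 3 with x
    funext i
    refine Fin.addCases (fun i => ?_) (fun j => ?_) i
    · rw [Fin.append_left, Fin.append_left]
    · rw [Fin.append_right, Fin.append_right]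
  | lrn F hG hH₁ hH₂ hK hbase heven hodd hbound ihG ih₁ ih₂ ihK =>
    intro hk f
    exact Cobham.lrn (F f) (ihG hk f) (ih₁ hk f) (ih₂ hk f) (ihK hk f)
      (hbase f) (heven f) (hodd f) (hbound f)

theorem Cobham.toBFF {l : ℕ} {F : (Fin l → ℕ) → ℕ} (h : Cobham l F) :
    BFF 0 l (fun _ x => F x) := by
  induction h with
  | zero => exact BFF.zero
  | s0 => exact BFF.s0
  | s1 => exact BFF.s1
  | proj n i => exact BFF.proj n i
  | smashF => exact BFF.smashF
  | @comp l m h g hh hg ihh ihg =>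
    have key := BFF.comp (BFF.expansion id (Fin.castAdd l) Function.injective_id
      (Fin.castAdd_injective m l) ihh) ihg
    simpa only [Fin.append_left] using key
  | lrn f hg hh₁ hh₂ hK hbase heven hodd hbound ihg ih₁ ih₂ ihK =>
    exact BFF.lrn (fun _ x => f x) ihg ih₁ ih₂ ihK (fun _ => hbase) (fun _ => heven)
      (fun _ => hodd) (fun _ => hbound)

/-- A function `F : ℕ^l → ℕ`, regarded as a type 2 functional of rank `(0,l)`, is a basic
feasible functional if and only if it belongs to Cobham's class. -/
theorem bff_rank_zero_iff_cobham (l : ℕ) (F : (Fin l → ℕ) → ℕ) :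
    BFF 0 l (fun _ x => F x) ↔ Cobham l F := by
  exact ⟨fun h => h.toCobham rfl Fin.elim0, fun h => h.toBFF⟩
end

section
/- Let K₁(u,α⃗) be any functional and define K̂ by K̂(0,α⃗) = 0 and, for u > 0, K̂(u,α⃗) = K̂(⌊u/2⌋,α⃗) if K₁(u,α⃗) ≤ K₁(K̂(⌊u/2⌋,α⃗),α⃗), and K̂(u,α⃗) = u otherwise. Then for all u and α⃗: K̂(u,α⃗) ≤ u, and K₁(K̂(u,α⃗),α⃗) = max{ K₁(u ↾ i, α⃗) : 0 ≤ i ≤ |u| }, where u ↾ i = ⌊u / 2^{|u| ∸ i}⌋ denotes the i most significant bits of u. In particular, if K₁ is a basic feasible functional then so are K̂ and K̄(u,α⃗) = K₁(K̂(u,α⃗),α⃗). -/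
/-- `x ↾ y`: the number consisting of the `y` most significant bits of `x`,
i.e. `⌊x / 2^(|x| ∸ y)⌋`. -/
def msp (x y : ℕ) : ℕ := x / 2 ^ (Nat.size x - y)

namespace KhatAux

theorem comp' {k l m : ℕ} {H : (Fin k → ℕ → ℕ) → (Fin m → ℕ) → ℕ}
    {G : Fin m → (Fin k → ℕ → ℕ) → (Fin l → ℕ) → ℕ}
    (hH : BFF k m H) (hG : ∀ i, BFF k l (G i)) :
    BFF k l (fun f x => H f (fun i => G i f x)) := by
  have h1 : BFF k (m + l) (fun f x => H f (fun j => x (Fin.castAdd l j))) :=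
    BFF.expansion (fun i => i) (Fin.castAdd l) (fun _ _ h => h)
      (Fin.castAdd_injective m l) hH
  have h2 := BFF.comp h1 hG
  simpa only [Fin.append_left] using h2

theorem lift {k m : ℕ} {g : (Fin m → ℕ) → ℕ} (h : BFF 0 m (fun _ x => g x)) :
    BFF k m (fun _ x => g x) :=
  BFF.expansion (Fin.elim0) (fun i => i) (fun a => a.elim0) (fun _ _ h => h) h

theorem pr {k l : ℕ} (i : Fin l) : BFF k l (fun _ x => x i) := lift (BFF.proj l i)

theorem app1 {k l : ℕ} {g : ℕ → ℕ} (h : BFF 0 1 (fun _ x => g (x 0)))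
    {A : (Fin k → ℕ → ℕ) → (Fin l → ℕ) → ℕ} (hA : BFF k l A) :
    BFF k l (fun f x => g (A f x)) :=
  comp' (G := fun _ => A) (lift (g := fun x => g (x 0)) h) (fun _ => hA)

theorem app2 {k l : ℕ} {g : ℕ → ℕ → ℕ} (h : BFF 0 2 (fun _ x => g (x 0) (x 1)))
    {A B : (Fin k → ℕ → ℕ) → (Fin l → ℕ) → ℕ} (hA : BFF k l A) (hB : BFF k l B) :
    BFF k l (fun f x => g (A f x) (B f x)) :=
  comp' (G := ![A, B]) (lift (g := fun x => g (x 0) (x 1)) h)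
    (by intro i; fin_cases i <;> assumption)

theorem app3 {k l : ℕ} {g : ℕ → ℕ → ℕ → ℕ} (h : BFF 0 3 (fun _ x => g (x 0) (x 1) (x 2)))
    {A B C : (Fin k → ℕ → ℕ) → (Fin l → ℕ) → ℕ} (hA : BFF k l A) (hB : BFF k l B)
    (hC : BFF k l C) :
    BFF k l (fun f x => g (A f x) (B f x) (C f x)) :=
  comp' (G := ![A, B, C]) (lift (g := fun x => g (x 0) (x 1) (x 2)) h)
    (by intro i; fin_cases i <;> assumption)

/-- Limited recursion on notation with two number parameters. -/
theorem rec2 (F : ℕ → ℕ → ℕ → ℕ) (G : ℕ → ℕ → ℕ) (H₁ H₂ : ℕ → ℕ → ℕ → ℕ → ℕ)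
    (K : ℕ → ℕ → ℕ → ℕ)
    (hG : BFF 0 2 (fun _ x => G (x 0) (x 1)))
    (hH₁ : BFF 0 4 (fun _ x => H₁ (x 0) (x 1) (x 2) (x 3)))
    (hH₂ : BFF 0 4 (fun _ x => H₂ (x 0) (x 1) (x 2) (x 3)))
    (hK : BFF 0 3 (fun _ x => K (x 0) (x 1) (x 2)))
    (h0 : ∀ a b, F a b 0 = G a b)
    (h1 : ∀ a b y, 0 < y → F a b (2 * y) = H₁ a b y (F a b y))
    (h2 : ∀ a b y, F a b (2 * y + 1) = H₂ a b y (F a b y))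
    (hb : ∀ a b y, F a b y ≤ K a b y) :
    BFF 0 3 (fun _ x => F (x 0) (x 1) (x 2)) :=
  BFF.lrn (l := 2) _ hG hH₁ hH₂ hK
    (fun _ x => h0 (x 0) (x 1))
    (fun _ x y hy => h1 (x 0) (x 1) y hy)
    (fun _ x y => h2 (x 0) (x 1) y)
    (fun _ x => Nat.size_le_size (hb _ _ _))

theorem zero {k l : ℕ} (i : Fin l) : BFF k l (fun _ _ => 0) :=
  app1 (g := fun _ => 0) BFF.zero (pr i)

theorem dbl {k l : ℕ} {A : (Fin k → ℕ → ℕ) → (Fin l → ℕ) → ℕ} (hA : BFF k l A) :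
    BFF k l (fun f x => 2 * A f x) := app1 (g := fun a => 2 * a) BFF.s0 hA

theorem dbl1 {k l : ℕ} {A : (Fin k → ℕ → ℕ) → (Fin l → ℕ) → ℕ} (hA : BFF k l A) :
    BFF k l (fun f x => 2 * A f x + 1) := app1 (g := fun a => 2 * a + 1) BFF.s1 hA

theorem one {k l : ℕ} (i : Fin l) : BFF k l (fun _ _ => 1) := dbl1 (zero i)

/-- A common bound. -/
def big (a b : ℕ) : ℕ := smash (2 * a + 1) (2 * b + 1)

theorem big_bff : BFF 0 2 (fun _ x => big (x 0) (x 1)) :=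
  app2 (g := smash) BFF.smashF (dbl1 (pr 0)) (dbl1 (pr 1))

theorem lt_big (a b : ℕ) : a < big a b ∧ b < big a b := by
  have ha := Nat.lt_size_self (2 * a + 1)
  have hb := Nat.lt_size_self (2 * b + 1)
  have pa : 0 < Nat.size (2 * a + 1) := Nat.size_pos.2 (by omega)
  have pb : 0 < Nat.size (2 * b + 1) := Nat.size_pos.2 (by omega)
  unfold big smash
  have h1 := Nat.pow_le_pow_right (n := 2) (by norm_num)
    (Nat.le_mul_of_pos_right (Nat.size (2 * a + 1)) pb)
  have h2 := Nat.pow_le_pow_right (n := 2) (by norm_num)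
    (Nat.le_mul_of_pos_left (Nat.size (2 * b + 1)) pa)
  constructor <;> omega

def cnd (a b c : ℕ) : ℕ := if c = 0 then a else b

theorem cnd_bff : BFF 0 3 (fun _ x => cnd (x 0) (x 1) (x 2)) :=
  rec2 cnd (fun a _ => a) (fun _ b _ _ => b) (fun _ b _ _ => b) (fun a b _ => big a b)
    (pr 0) (pr 1) (pr 1) (app2 big_bff (pr 0) (pr 1))
    (by intros; simp [cnd]) (by intro a b y hy; simp [cnd]; omega) (by intros; simp [cnd])
    (by
      intro a b y
      have := lt_big a b
      unfold cnd
      split_ifs <;> omega)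

theorem half_bff : BFF 0 1 (fun _ x => x 0 / 2) :=
  app3 (g := fun _ _ y => y / 2)
    (rec2 (fun _ _ y => y / 2) (fun _ _ => 0) (fun _ _ y _ => y) (fun _ _ y _ => y)
      (fun _ _ y => y) (zero 0) (pr 2) (pr 2) (pr 2)
      (by intros; rfl) (by intros; omega) (by intros; omega) (by intros; omega))
    (pr 0) (pr 0) (pr 0)

theorem par_bff : BFF 0 1 (fun _ x => x 0 % 2) :=
  app3 (g := fun _ _ y => y % 2)
    (rec2 (fun _ _ y => y % 2) (fun _ _ => 0) (fun _ _ _ _ => 0) (fun _ _ _ _ => 1)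
      (fun _ _ y => y) (zero 0) (zero 0) (one 0) (pr 2)
      (by intros; rfl) (by intros; omega) (by intros; omega) (by intros; omega))
    (pr 0) (pr 0) (pr 0)

theorem size_dbl {y : ℕ} (hy : 0 < y) : Nat.size (2 * y) = Nat.size y + 1 := by
  have := Nat.size_bit (b := false) (n := y) (by simp [Nat.bit]; omega)
  simpa [Nat.bit] using this

theorem size_dbl1 (y : ℕ) : Nat.size (2 * y + 1) = Nat.size y + 1 := by
  have := Nat.size_bit (b := true) (n := y) (by simp [Nat.bit])
  simpa [Nat.bit] using this

/-- Shift `a` right by the length of `y`. -/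
def shr (a y : ℕ) : ℕ := a / 2 ^ Nat.size y

theorem shr_bff : BFF 0 2 (fun _ x => shr (x 0) (x 1)) :=
  app3 (g := fun a _ y => shr a y)
    (rec2 (fun a _ y => shr a y) (fun a _ => a) (fun _ _ _ z => z / 2) (fun _ _ _ z => z / 2)
      (fun a _ _ => a) (pr 0) (app1 (g := fun z => z / 2) half_bff (pr 3))
      (app1 (g := fun z => z / 2) half_bff (pr 3)) (pr 0)
      (by intros; simp [shr])
      (by intro a b y hy; simp [shr, size_dbl hy, Nat.pow_succ, Nat.div_div_eq_div_mul])
      (by intro a b y; simp [shr, size_dbl1, Nat.pow_succ, Nat.div_div_eq_div_mul])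
      (by intros; exact Nat.div_le_self _ _))
    (pr 0) (pr 0) (pr 1)

def cmp (a b y : ℕ) : ℕ := if a % 2 ^ Nat.size y ≤ b % 2 ^ Nat.size y then 0 else 1

def cmpStep (a b y z : ℕ) : ℕ :=
  cnd (cnd z 0 (shr b y % 2)) (cnd 1 z (shr b y % 2)) (shr a y % 2)

theorem cmpStep_bff : BFF 0 4 (fun _ x => cmpStep (x 0) (x 1) (x 2) (x 3)) := by
  have ha : BFF 0 4 (fun _ x => shr (x 0) (x 2) % 2) :=
    app1 (g := fun z => z % 2) par_bff (app2 shr_bff (pr 0) (pr 2))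
  have hb : BFF 0 4 (fun _ x => shr (x 1) (x 2) % 2) :=
    app1 (g := fun z => z % 2) par_bff (app2 shr_bff (pr 1) (pr 2))
  exact app3 cnd_bff (app3 cnd_bff (pr 3) (zero 0) hb) (app3 cnd_bff (one 0) (pr 3) hb) ha

theorem cmp_step (a b y y' : ℕ) (h : Nat.size y' = Nat.size y + 1) :
    cmp a b y' = cmpStep a b y (cmp a b y) := by
  unfold cmp cmpStep cnd shr
  rw [h, Nat.mod_pow_succ, Nat.mod_pow_succ]
  have pa := Nat.mod_lt a (y := 2 ^ Nat.size y) (by positivity)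
  have pb := Nat.mod_lt b (y := 2 ^ Nat.size y) (by positivity)
  rcases Nat.mod_two_eq_zero_or_one (a / 2 ^ Nat.size y) with h1 | h1 <;>
  rcases Nat.mod_two_eq_zero_or_one (b / 2 ^ Nat.size y) with h2 | h2 <;>
  simp only [h1, h2] <;> split_ifs <;> omega

theorem cmp_bff : BFF 0 3 (fun _ x => cmp (x 0) (x 1) (x 2)) :=
  rec2 cmp (fun _ _ => 0) cmpStep cmpStep (fun _ _ _ => 1)
    (zero 0) cmpStep_bff cmpStep_bff (one 0)
    (by intro a b; simp [cmp, Nat.mod_one])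
    (by intro a b y hy; exact cmp_step _ _ _ _ (size_dbl hy))
    (by intro a b y; exact cmp_step _ _ _ _ (size_dbl1 y))
    (by intro a b y; unfold cmp; split_ifs <;> omega)

theorem gt_bff : BFF 0 2 (fun _ x => if x 0 ≤ x 1 then 0 else 1) := by
  have h : BFF 0 2 (fun _ x => cmp (x 0) (x 1) (big (x 0) (x 1))) :=
    app3 cmp_bff (pr 0) (pr 1) (app2 big_bff (pr 0) (pr 1))
  convert h using 3 with f x
  have h1 := lt_big (x 0) (x 1)
  have h2 := Nat.lt_size_self (big (x 0) (x 1))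
  unfold cmp
  rw [Nat.mod_eq_of_lt (by omega), Nat.mod_eq_of_lt (by omega)]

theorem ite_bff {k l : ℕ} {A B C D : (Fin k → ℕ → ℕ) → (Fin l → ℕ) → ℕ}
    (hA : BFF k l A) (hB : BFF k l B) (hC : BFF k l C) (hD : BFF k l D) :
    BFF k l (fun f x => if A f x ≤ B f x then C f x else D f x) := by
  have h := app3 cnd_bff hC hD (app2 (g := fun a b => if a ≤ b then 0 else 1) gt_bff hA hB)
  convert h using 3 with f x
  unfold cnd
  split_ifs <;> simp_all

theorem subst_bff {k l m : ℕ} {K₁ : (Fin k → ℕ → ℕ) → (Fin (l + 1) → ℕ) → ℕ}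
    (hK : BFF k (l + 1) K₁) {A : (Fin k → ℕ → ℕ) → (Fin m → ℕ) → ℕ} (hA : BFF k m A)
    (σ : Fin l → Fin m) :
    BFF k m (fun f x => K₁ f (Fin.cons (A f x) (fun i => x (σ i)))) := by
  have h := comp' (G := Fin.cons A (fun i _ x => x (σ i))) hK
    (by
      intro i
      refine Fin.cases ?_ (fun j => ?_) i
      · simpa using hA
      · simpa using pr (σ j))
  convert h using 4 with f x i
  refine funext fun i => ?_
  refine Fin.cases ?_ (fun j => ?_) i <;> simp

end KhatAux


open KhatAux

/-- Let `K̂` be defined from `K₁` by `K̂(0,α⃗) = 0` and, for `u > 0`,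
`K̂(u,α⃗) = K̂(⌊u/2⌋,α⃗)` if `K₁(u,α⃗) ≤ K₁(K̂(⌊u/2⌋,α⃗),α⃗)` and `K̂(u,α⃗) = u` otherwise.
Then `K̂(u,α⃗) ≤ u`, `K₁(K̂(u,α⃗),α⃗) = max { K₁(u ↾ i, α⃗) : 0 ≤ i ≤ |u| }`, and if `K₁` is
basic feasible then so are `K̂` and `K̄(u,α⃗) = K₁(K̂(u,α⃗),α⃗)`. -/
theorem khat_properties (k l : ℕ)
    (K₁ Khat : (Fin k → ℕ → ℕ) → (Fin (l + 1) → ℕ) → ℕ)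
    (hzero : ∀ f x, Khat f (Fin.cons 0 x) = 0)
    (hrec : ∀ f x u, 0 < u → Khat f (Fin.cons u x) =
      if K₁ f (Fin.cons u x) ≤ K₁ f (Fin.cons (Khat f (Fin.cons (u / 2) x)) x)
      then Khat f (Fin.cons (u / 2) x) else u) :
    (∀ f x u, Khat f (Fin.cons u x) ≤ u) ∧
    (∀ f x u, K₁ f (Fin.cons (Khat f (Fin.cons u x)) x) =
      (Finset.range (Nat.size u + 1)).sup fun i => K₁ f (Fin.cons (msp u i) x)) ∧
    (BFF k (l + 1) K₁ →
      BFF k (l + 1) Khat ∧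
      BFF k (l + 1) (fun f v => K₁ f (Fin.cons (Khat f v) (Fin.tail v)))) := by
  have hle : ∀ f x u, Khat f (Fin.cons u x) ≤ u := by
    intro f x u
    induction u using Nat.strong_induction_on with
    | _ u ih =>
      rcases Nat.eq_zero_or_pos u with rfl | hu
      · rw [hzero]
      · rw [hrec f x u hu]
        have := ih (u / 2) (by omega)
        split_ifs <;> omega
  refine ⟨hle, ?_, ?_⟩
  · intro f x u
    induction u using Nat.strong_induction_on with
    | _ u ih =>
      rcases Nat.eq_zero_or_pos u with rfl | hu
      · simp [hzero, msp]
      · have hs : Nat.size u = Nat.size (u / 2) + 1 := by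
          rcases Nat.even_or_odd' u with ⟨c, rfl | rfl⟩
          · rw [size_dbl (by omega)]; congr 2; omega
          · rw [size_dbl1]; congr 2; omega
        have ih' := ih (u / 2) (by omega)
        have hlast : msp u (Nat.size (u / 2) + 1) = u := by simp [msp, hs]
        have hcongr : ((Finset.range (Nat.size (u / 2) + 1)).sup
            fun i => K₁ f (Fin.cons (msp u i) x)) =
            (Finset.range (Nat.size (u / 2) + 1)).sup
              fun i => K₁ f (Fin.cons (msp (u / 2) i) x) := by
          refine Finset.sup_congr rfl fun i hi => ?_
          have hi' := Finset.mem_range.1 hi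
          have : msp u i = msp (u / 2) i := by
            unfold msp
            rw [hs, Nat.div_div_eq_div_mul, ← Nat.pow_succ']
            congr 2
            omega
          rw [this]
        rw [hs, Finset.range_add_one, Finset.sup_insert, hlast, hcongr, ← ih', hrec f x u hu]
        split_ifs with h
        · exact (max_eq_right h).symm
        · exact (max_eq_left (by omega)).symm
  · intro hK
    have hF : BFF k (l + 1 + 1)
        (fun f w => Khat f (Fin.cons (w (Fin.last (l + 1)))
          (fun i => w (Fin.castSucc (Fin.succ i))))) := by
      let σ : Fin l → Fin (l + 1 + 2) := fun i => Fin.castSucc (Fin.castSucc (Fin.succ i))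
      have hz : BFF k (l + 1 + 2) (fun _ w => w (Fin.last (l + 2))) := pr _
      have hy : BFF k (l + 1 + 2) (fun _ w => w (Fin.castSucc (Fin.last (l + 1)))) := pr _
      have hH : ∀ {D : (Fin k → ℕ → ℕ) → (Fin (l + 1 + 2) → ℕ) → ℕ}, BFF k (l + 1 + 2) D →
          BFF k (l + 1 + 2) (fun f w =>
            if K₁ f (Fin.cons (D f w) (fun i => w (σ i))) ≤
              K₁ f (Fin.cons (w (Fin.last (l + 2))) (fun i => w (σ i)))
            then w (Fin.last (l + 2)) else D f w) := fun hD =>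
        ite_bff (subst_bff hK hD σ) (subst_bff hK hz σ) hz hD
      refine BFF.lrn (l := l + 1) _ (zero 0) (hH (dbl hy)) (hH (dbl1 hy)) (pr (Fin.last (l + 1)))
        ?_ ?_ ?_ ?_
      · intro f x
        simp only [Fin.snoc_last, hzero]
      · intro f x y hy
        simp only [Fin.snoc_last, Fin.snoc_castSucc, σ]
        rw [hrec f _ (2 * y) (by omega), show 2 * y / 2 = y by omega]
      · intro f x y
        simp only [Fin.snoc_last, Fin.snoc_castSucc, σ]
        rw [hrec f _ (2 * y + 1) (by omega), show (2 * y + 1) / 2 = y by omega]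
      · intro f x
        exact Nat.size_le_size (hle _ _ _)
    have hKhat : BFF k (l + 1) Khat := by
      have h := comp' (G := Fin.snoc (α := fun _ => (Fin k → ℕ → ℕ) → (Fin (l + 1) → ℕ) → ℕ)
          (fun i _ x => x i) (fun _ x => x 0)) hF
        (by
          intro i
          refine Fin.lastCases ?_ (fun j => ?_) i
          · simpa using pr 0
          · simpa using pr j)
      simp only [Fin.snoc_last, Fin.snoc_castSucc] at h
      convert h using 3 with f x
      exact congrArg (Khat f) (Fin.cons_self_tail x).symm
    exact ⟨hKhat, subst_bff hK hKhat Fin.succ⟩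
end
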